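/- arXiv:1601.06890 — 2 statements merged into one kernel-verified Lean document; each statement's English description precedes it below -/
import Mathlib

section
/- Let G be a balanced bipartite graph on 2n vertices with δ(G) ≥ k, where k ≥ 0 and n ≥ (k+2)². If q(G) ≥ q(Q_n^k), then G is traceable unless G = Q_n^k. -/
open SimpleGraph

attribute [local instance] Classical.propDecidable

/-- The (adjacency) spectral radius of a graph, as the largest adjacency eigenvalue. -/
noncomputable def specRad {V : Type*} [Fintype V] [DecidableEq V] (G : SimpleGraph V) : ℝ :=
  sSup (spectrum ℝ (G.adjMatrix ℝ))

/-- The signless Laplacian matrix `Q = D + A` of a graph. -/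
noncomputable def signlessLaplacian {V : Type*} [Fintype V] [DecidableEq V]
    (G : SimpleGraph V) : Matrix V V ℝ :=
  Matrix.diagonal (fun v => (G.degree v : ℝ)) + G.adjMatrix ℝ

/-- The signless Laplacian spectral radius of a graph. -/
noncomputable def qSpec {V : Type*} [Fintype V] [DecidableEq V] (G : SimpleGraph V) : ℝ :=
  sSup (spectrum ℝ (signlessLaplacian G))

/-- A graph is traceable if it has a Hamilton path. -/
def SimpleGraph.IsTraceable {V : Type*} (G : SimpleGraph V) : Prop :=
  ∃ (u v : V) (p : G.Walk u v), p.IsHamiltonian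

/-- A graph on `Fin m ⊕ Fin n` is bipartite with bipartition `{Fin m, Fin n}`:
all edges go between the two parts. -/
def CrossOnly {m n : ℕ} (G : SimpleGraph (Fin m ⊕ Fin n)) : Prop :=
  (∀ x y : Fin m, ¬ G.Adj (Sum.inl x) (Sum.inl y)) ∧
  (∀ x y : Fin n, ¬ G.Adj (Sum.inr x) (Sum.inr y))

/-- The graph `Q_n^k = K_{k,n-k-1} ⊔ Φ_{n-k,k+1}`: a vertex `inl x` with `x < k` is joined to
all of the right side, a vertex `inr y` with `y < n-k-1` is joined to all of the left side,
and there are no other edges. -/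
def Qgraph (n k : ℕ) : SimpleGraph (Fin n ⊕ Fin n) :=
  SimpleGraph.fromRel (fun a b =>
    match a, b with
    | Sum.inl x, Sum.inr y => x.val < k ∨ y.val < n - k - 1
    | _, _ => False)

/-- The graph `R_n^k = K_{k,k} ∪ K_{n-k,n-k}` (disjoint union). -/
def Rgraph (n k : ℕ) : SimpleGraph (Fin n ⊕ Fin n) :=
  SimpleGraph.fromRel (fun a b =>
    match a, b with
    | Sum.inl x, Sum.inr y => (x.val < k ∧ y.val < k) ∨ (k ≤ x.val ∧ k ≤ y.val)
    | _, _ => False)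

/-- The graph `S_n^k = K_{k,n-k-1} ⊔ Φ_{n-k,k}` on parts of sizes `n` and `n-1`. -/
def Sgraph (n k : ℕ) : SimpleGraph (Fin n ⊕ Fin (n - 1)) :=
  SimpleGraph.fromRel (fun a b =>
    match a, b with
    | Sum.inl x, Sum.inr y => x.val < k ∨ y.val < n - k - 1
    | _, _ => False)

/-- The quasi-complement of a bipartite graph: `inl x` and `inr y` are adjacent iff they are
nonadjacent in `G`; no edges inside the parts. -/
def quasiComplement {m n : ℕ} (G : SimpleGraph (Fin m ⊕ Fin n)) : SimpleGraph (Fin m ⊕ Fin n) :=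
  SimpleGraph.fromRel (fun a b =>
    match a, b with
    | Sum.inl x, Sum.inr y => ¬ G.Adj (Sum.inl x) (Sum.inr y)
    | _, _ => False)

/-- `G` is isomorphic to a subgraph of `H`. -/
def IsoSubgraph {V W : Type*} (G : SimpleGraph V) (H : SimpleGraph W) : Prop :=
  ∃ H' : SimpleGraph W, H' ≤ H ∧ Nonempty (G ≃g H')


section LinAlg

variable {V : Type*} [Fintype V] [DecidableEq V]

lemma sl_mulVec (G : SimpleGraph V) (v : V → ℝ) (a : V) :
    (signlessLaplacian G).mulVec v a = ∑ b, if G.Adj a b then v a + v b else 0 := by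
  classical
  unfold signlessLaplacian
  rw [Matrix.add_mulVec, Pi.add_apply, Matrix.mulVec_diagonal, SimpleGraph.adjMatrix_mulVec_apply]
  rw [← SimpleGraph.card_neighborFinset_eq_degree]
  have h : ∀ b, (if G.Adj a b then v a + v b else 0) = if b ∈ G.neighborFinset a then v a + v b else 0 := by
    intro b; simp
  simp_rw [h]
  rw [Finset.sum_ite_mem, Finset.univ_inter, Finset.sum_add_distrib, Finset.sum_const, nsmul_eq_mul]

lemma sl_symm (G : SimpleGraph V) : (signlessLaplacian G).IsSymm := by
  unfold signlessLaplacian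
  exact (Matrix.isSymm_diagonal _).add (SimpleGraph.isSymm_adjMatrix (α := ℝ) G)

lemma sl_herm (G : SimpleGraph V) : (signlessLaplacian G).IsHermitian := by
  have := sl_symm G
  unfold Matrix.IsHermitian
  rw [Matrix.conjTranspose_eq_transpose_of_trivial]
  exact this

/-- Rayleigh bound. -/
lemma rayleigh (G : SimpleGraph V) (v : V → ℝ) :
    dotProduct v ((signlessLaplacian G).mulVec v) ≤ qSpec G * dotProduct v v := by
  set A := signlessLaplacian G with hA
  set q := qSpec G with hq
  have hbdd : BddAbove (spectrum ℝ A) := (Matrix.finite_real_spectrum (A := A)).bddAbove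
  have hle : ∀ μ ∈ spectrum ℝ A, μ ≤ q := fun μ hμ => le_csSup hbdd hμ
  have hB : (algebraMap ℝ (Matrix V V ℝ) q - A).IsHermitian := by
    refine Matrix.IsHermitian.sub ?_ (sl_herm G)
    rw [Algebra.algebraMap_eq_smul_one]
    unfold Matrix.IsHermitian
    simp
  have hpsd : (algebraMap ℝ (Matrix V V ℝ) q - A).PosSemidef := by
    rw [hB.posSemidef_iff_eigenvalues_nonneg]
    intro i
    have := hB.eigenvalues_mem_spectrum_real i
    rw [← spectrum.singleton_sub_eq] at this
    obtain ⟨a, ha, b, hb, hab⟩ := Set.mem_sub.1 this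
    have := hle b hb
    simp only [Set.mem_singleton_iff] at ha
    show 0 ≤ hB.eigenvalues i
    linarith
  have h := hpsd.dotProduct_mulVec_nonneg v
  rw [Matrix.sub_mulVec, Algebra.algebraMap_eq_smul_one, Matrix.smul_mulVec, Matrix.one_mulVec] at h
  simp only [star_trivial, dotProduct_sub, dotProduct_smul, smul_eq_mul] at h
  linarith

lemma exists_top [Nonempty V] (G : SimpleGraph V) :
    ∃ v : V → ℝ, v ≠ 0 ∧ (signlessLaplacian G).mulVec v = qSpec G • v := by
  have hne : (spectrum ℝ (signlessLaplacian G)).Nonempty := by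
    rw [(sl_herm G).spectrum_real_eq_range_eigenvalues]
    exact Set.range_nonempty _
  have hmem : qSpec G ∈ spectrum ℝ (signlessLaplacian G) :=
    hne.csSup_mem (Matrix.finite_real_spectrum (A := signlessLaplacian G))
  rw [(sl_herm G).spectrum_real_eq_range_eigenvalues] at hmem
  obtain ⟨j, hj⟩ := hmem
  refine ⟨(sl_herm G).eigenvectorBasis j, ?_, ?_⟩
  · intro h0
    have h1 := (sl_herm G).eigenvectorBasis.orthonormal.1 j
    have : (sl_herm G).eigenvectorBasis j = 0 := by
      ext i; exact congrFun h0 i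
    rw [this] at h1
    simp at h1
  · rw [← hj]
    exact (sl_herm G).mulVec_eigenvectorBasis j

lemma eq_of_rayleigh (G : SimpleGraph V) (v : V → ℝ)
    (h : qSpec G * dotProduct v v ≤ dotProduct v ((signlessLaplacian G).mulVec v)) :
    (signlessLaplacian G).mulVec v = qSpec G • v := by
  set A := signlessLaplacian G with hA
  set q := qSpec G with hq
  set g := q • v - A.mulVec v with hg
  have hs : ∀ a b : V → ℝ, dotProduct a (A.mulVec b) = dotProduct b (A.mulVec a) := by
    intro a b
    rw [Matrix.dotProduct_mulVec, ← Matrix.mulVec_transpose, (sl_symm G).eq, dotProduct_comm]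
  have hv : dotProduct v (A.mulVec v) = q * dotProduct v v := le_antisymm (rayleigh G v) h
  have key : ∀ t : ℝ, 0 ≤ 2 * t * dotProduct g g + t ^ 2 * (q * dotProduct g g - dotProduct g (A.mulVec g)) := by
    intro t
    have h1 := rayleigh G (v + t • g)
    rw [Matrix.mulVec_add, Matrix.mulVec_smul] at h1
    simp only [add_dotProduct, dotProduct_add, smul_dotProduct, dotProduct_smul, smul_eq_mul] at h1
    have h2 : dotProduct g g = q * dotProduct g v - dotProduct g (A.mulVec v) := by
      conv_lhs => rw [hg]
      rw [sub_dotProduct, smul_dotProduct, smul_eq_mul, dotProduct_comm v, dotProduct_comm _ g]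
    have h3 := hs v g
    have h4 := dotProduct_comm v g
    rw [← hA, ← hq] at h1
    rw [h3, h4, hv] at h1
    have h5 : 2 * t * dotProduct g g = 2 * t * (q * g ⬝ᵥ v - g ⬝ᵥ A.mulVec v) := by rw [← h2]
    rw [h5]
    linarith
  have hgg : 0 ≤ dotProduct g g := by
    unfold dotProduct; exact Finset.sum_nonneg fun i _ => mul_self_nonneg _
  have hg0 : dotProduct g g = 0 := by
    by_contra hne
    have hpos : 0 < dotProduct g g := lt_of_le_of_ne hgg (Ne.symm hne)
    set P := dotProduct g g
    set R := q * P - dotProduct g (A.mulVec g)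
    have hR : 0 ≤ R := by have := rayleigh G g; simp only [R, P]; linarith
    have := key (-(P / (R + P)))
    have hRP : 0 < R + P := by linarith
    have e : 2 * -(P / (R + P)) * P + (-(P / (R + P))) ^ 2 * R = -(P^2 / (R+P)^2 * (R + 2 * P)) := by
      field_simp; ring
    rw [e] at this
    have : 0 < P^2 / (R+P)^2 * (R + 2 * P) := by positivity
    linarith
  have := dotProduct_self_eq_zero.1 hg0
  rw [hg, sub_eq_zero] at this
  exact this.symm

/-- Existence of a nonnegative top eigenvector. -/
lemma exists_top_nonneg [Nonempty V] (G : SimpleGraph V) :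
    ∃ v : V → ℝ, v ≠ 0 ∧ (∀ a, 0 ≤ v a) ∧ (signlessLaplacian G).mulVec v = qSpec G • v := by
  obtain ⟨v, hv0, hv⟩ := exists_top G
  refine ⟨fun a => |v a|, ?_, fun a => abs_nonneg _, ?_⟩
  · intro h; apply hv0; ext a; have := congrFun h a; simpa using this
  · apply eq_of_rayleigh
    have h1 : dotProduct (fun a => |v a|) (fun a => |v a|) = dotProduct v v := by
      unfold dotProduct; apply Finset.sum_congr rfl; intro a _; exact abs_mul_abs_self _
    rw [h1]
    have h2 : dotProduct v ((signlessLaplacian G).mulVec v) = qSpec G * dotProduct v v := by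
      rw [hv, dotProduct_smul, smul_eq_mul]
    rw [← h2]
    unfold dotProduct
    apply Finset.sum_le_sum
    intro a _
    rw [sl_mulVec, sl_mulVec, Finset.mul_sum, Finset.mul_sum]
    apply Finset.sum_le_sum
    intro b _
    split_ifs
    · have e1 := abs_mul_abs_self (v a)
      have e2 := le_abs_self (v a * v b)
      rw [abs_mul] at e2
      nlinarith
    · simp

lemma qSpec_le [Nonempty V] (G : SimpleGraph V) (C : ℝ) (hC : 0 ≤ C)
    (h : ∀ a, ∑ b, (if G.Adj a b then (G.degree b : ℝ) else 0) ≤ (C - G.degree a) * G.degree a) :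
    qSpec G ≤ C := by
  classical
  obtain ⟨v, hv0, hv⟩ := exists_top G
  have h2 : dotProduct v ((signlessLaplacian G).mulVec v) = qSpec G * dotProduct v v := by
    rw [hv, dotProduct_smul, smul_eq_mul]
  have hpos : 0 < dotProduct v v := by
    have : 0 ≤ dotProduct v v := by
      unfold dotProduct; exact Finset.sum_nonneg fun i _ => mul_self_nonneg _
    refine lt_of_le_of_ne this fun h => hv0 (dotProduct_self_eq_zero.1 h.symm)
  suffices dotProduct v ((signlessLaplacian G).mulVec v) ≤ C * dotProduct v v by
    rw [h2] at this
    exact le_of_mul_le_mul_right this hpos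
  -- the weights
  let d : V → ℝ := fun a => (G.degree a : ℝ)
  have hd : ∀ a b, G.Adj a b → 0 < d a := by
    intro a b hab
    have : 0 < G.degree a := by
      rw [SimpleGraph.degree_pos_iff_exists_adj]; exact ⟨b, hab⟩
    show (0:ℝ) < (G.degree a : ℝ)
    exact_mod_cast this
  have hdsum : ∀ a, ∑ b, (if G.Adj a b then (1:ℝ) else 0) = d a := by
    intro a
    simp only [d, ← SimpleGraph.card_neighborFinset_eq_degree]
    rw [Finset.sum_boole]
    congr 2
    ext b; simp
  have hform : dotProduct v ((signlessLaplacian G).mulVec v)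
      = ∑ a, ∑ b, if G.Adj a b then v a * v a + v a * v b else 0 := by
    unfold dotProduct
    apply Finset.sum_congr rfl; intro a _
    rw [sl_mulVec, Finset.mul_sum]
    apply Finset.sum_congr rfl; intro b _
    split_ifs <;> ring
  let W : V → V → ℝ := fun a b => if G.Adj a b then v a * v a * (d b / d a) else 0
  have hsw : ∑ a, ∑ b, W a b = ∑ a, ∑ b, W b a := Finset.sum_comm
  have hb : ∑ a, ∑ b, (if G.Adj a b then v a * v a + v a * v b else 0)
      ≤ ∑ a, ∑ b, ((if G.Adj a b then v a * v a else 0) + (W a b + W b a) / 2) := by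
    apply Finset.sum_le_sum; intro a _
    apply Finset.sum_le_sum; intro b _
    by_cases hab : G.Adj a b
    · simp only [W, hab, hab.symm, if_true]
      have ha := hd a b hab
      have hb := hd b a hab.symm
      have : v a * v a * (d b / d a) + v b * v b * (d a / d b) - 2 * (v a * v b)
          = (v a * d b - v b * d a)^2 / (d a * d b) := by
        field_simp; ring
      have h0 : 0 ≤ (v a * d b - v b * d a)^2 / (d a * d b) := by positivity
      linarith
    · have hba : ¬ G.Adj b a := fun h => hab h.symm
      simp [W, hab, hba]
  have hc : ∑ a, ∑ b, ((if G.Adj a b then v a * v a else 0) + (W a b + W b a) / 2)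
      = ∑ a, ∑ b, ((if G.Adj a b then v a * v a else 0) + W a b) := by
    simp only [Finset.sum_add_distrib, ← Finset.sum_div]
    rw [← hsw]; ring
  rw [hform]
  refine hb.trans (hc.le.trans ?_)
  unfold dotProduct
  rw [Finset.mul_sum]
  apply Finset.sum_le_sum; intro a _
  rw [Finset.sum_add_distrib]
  have e1 : ∑ b, (if G.Adj a b then v a * v a else 0) = v a * v a * d a := by
    rw [← hdsum a, Finset.mul_sum]
    apply Finset.sum_congr rfl; intro b _; split_ifs <;> ring
  have e2 : ∑ b, W a b = v a * v a * ((∑ b, if G.Adj a b then d b else 0) / d a) := by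
    rw [Finset.sum_div, Finset.mul_sum]
    apply Finset.sum_congr rfl; intro b _; simp only [W]; split_ifs <;> simp
  rw [e1, e2]
  have h3 := h a
  by_cases hda : d a = 0
  · have hno : ∀ b, ¬ G.Adj a b := fun b hab => (hd a b hab).ne' hda
    rw [hda]
    simp only [div_zero, mul_zero, add_zero]
    exact mul_nonneg hC (mul_self_nonneg _)
  · have hp : 0 < d a := lt_of_le_of_ne (by simp [d]) (Ne.symm hda)
    have : (∑ b, if G.Adj a b then d b else 0) / d a ≤ C - d a := by
      rw [div_le_iff₀ hp]; exact h3
    have := mul_le_mul_of_nonneg_left this (mul_self_nonneg (v a))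
    linarith

lemma qSpec_iso {W : Type*} [Fintype W] [DecidableEq W] {G : SimpleGraph V} {H : SimpleGraph W}
    (e : G ≃g H) : qSpec G = qSpec H := by
  unfold qSpec
  have : signlessLaplacian H = Matrix.reindexAlgEquiv ℝ ℝ e.toEquiv (signlessLaplacian G) := by
    ext i j
    simp only [Matrix.coe_reindexAlgEquiv, Matrix.reindex_apply, Matrix.submatrix_apply]
    unfold signlessLaplacian
    obtain ⟨i, rfl⟩ := e.surjective i
    obtain ⟨j, rfl⟩ := e.surjective j
    have h1 : e.toEquiv.symm (e i) = i := e.toEquiv.symm_apply_apply i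
    have h2 : e.toEquiv.symm (e j) = j := e.toEquiv.symm_apply_apply j
    rw [h1, h2]
    simp only [Matrix.add_apply, SimpleGraph.adjMatrix_apply, Matrix.diagonal_apply,
      e.map_adj_iff, e.injective.eq_iff]
    congr 2
    have := e.degree_eq i
    congr 1
  rw [this, AlgEquiv.spectrum_eq]

end LinAlg

section Lists

/-- Hamilton path as a list. -/
def TrL {V : Type*} (G : SimpleGraph V) : Prop :=
  ∃ l : List V, l.IsChain G.Adj ∧ l.Nodup ∧ ∀ v, v ∈ l

lemma isTraceable_of_trL {V : Type*} [Nonempty V] {G : SimpleGraph V} (h : TrL G) :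
    G.IsTraceable := by
  obtain ⟨l, hc, hn, hm⟩ := h
  have hne : l ≠ [] := by
    rintro rfl
    obtain ⟨v⟩ := ‹Nonempty V›
    simpa using hm v
  refine ⟨_, _, SimpleGraph.Walk.ofSupport l hne hc, ?_⟩
  intro a
  rw [SimpleGraph.Walk.support_ofSupport]
  exact List.count_eq_one_of_mem hn (hm a)

lemma trL_mono {V : Type*} {G H : SimpleGraph V} (hle : G ≤ H) (h : TrL G) : TrL H := by
  obtain ⟨l, hc, hn, hm⟩ := h
  exact ⟨l, hc.imp fun a b hab => hle hab, hn, hm⟩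

lemma trL_iso {V W : Type*} {G : SimpleGraph V} {H : SimpleGraph W} (e : G ≃g H) (h : TrL G) :
    TrL H := by
  obtain ⟨l, hc, hn, hm⟩ := h
  refine ⟨l.map e, ?_, hn.map e.injective, fun w => ?_⟩
  · rw [List.isChain_map]
    exact hc.imp fun a b hab => e.map_adj_iff.2 hab
  · obtain ⟨v, rfl⟩ := e.surjective w
    exact List.mem_map_of_mem (hm v)

lemma isChain_rev {V : Type*} {G : SimpleGraph V} {l : List V} (h : l.IsChain G.Adj) :
    l.reverse.IsChain G.Adj := by
  rw [List.isChain_reverse]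
  exact h.imp fun a b hab => hab.symm

/-- Rotation: no consecutive pair `v, w` with `X ~ v` and `Y ~ w`. -/
lemma path_rotation {V : Type*} {H : SimpleGraph V} {A B : List V} {X Y : V}
    (hA : A.IsChain H.Adj) (hB : B.IsChain H.Adj) (hX : A.getLast? = some X)
    (hY : B.head? = some Y) (hn : (A ++ B).Nodup) (hm : ∀ v, v ∈ A ++ B) (hT : ¬ TrL H)
    {P S : List V} {v w : V} (hPS : A ++ B = P ++ S) (hv : P.getLast? = some v)
    (hw : S.head? = some w) (hXv : H.Adj X v) (hYw : H.Adj Y w) : False := by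
  apply hT
  rcases List.append_eq_append_iff.1 hPS with ⟨E, hP, hE⟩ | ⟨E, hP, hE⟩
  · -- P = A ++ E, B = E ++ S
    have hE0 : E ≠ [] := by
      rintro rfl
      rw [List.append_nil] at hP
      rw [hP, hX] at hv
      simp only [Option.some.injEq] at hv
      subst hv
      exact hXv.ne rfl
    have hEl : E.getLast? = some v := by
      rw [hP, List.getLast?_append_of_ne_nil _ hE0] at hv; exact hv
    have hEh : E.head? = some Y := by
      rw [hE, List.head?_append_of_ne_nil _ hE0] at hY; exact hY
    rw [hE] at hB
    obtain ⟨hB1, hB2, -⟩ := List.isChain_append.1 hB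
    have hperm : (A ++ (E.reverse ++ S)).Perm (A ++ B) := by
      rw [hE]
      exact List.Perm.append_left _ (List.Perm.append_right _ (List.reverse_perm E))
    refine ⟨A ++ (E.reverse ++ S), ?_, hperm.nodup_iff.2 hn, fun u => hperm.mem_iff.2 (hm u)⟩
    rw [List.isChain_append]
    refine ⟨hA, ?_, ?_⟩
    · rw [List.isChain_append]
      refine ⟨isChain_rev hB1, hB2, ?_⟩
      intro a ha b hb
      rw [List.getLast?_reverse, hEh] at ha
      rw [hw] at hb
      simp only [Option.mem_some_iff] at ha hb
      subst ha hb; exact hYw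
    · intro a ha b hb
      rw [List.head?_append_of_ne_nil _ (by simpa using hE0), List.head?_reverse, hEl] at hb
      rw [hX] at ha
      simp only [Option.mem_some_iff] at ha hb
      subst ha hb; exact hXv
  · -- A = P ++ E, S = E ++ B
    have hE0 : E ≠ [] := by
      rintro rfl
      rw [List.append_nil] at hP
      rw [← hP, hX] at hv
      simp only [Option.some.injEq] at hv
      subst hv
      exact hXv.ne rfl
    have hEl : E.getLast? = some X := by
      rw [hP, List.getLast?_append_of_ne_nil _ hE0] at hX; exact hX
    have hEh : E.head? = some w := by
      rw [hE, List.head?_append_of_ne_nil _ hE0] at hw; exact hw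
    rw [hP] at hA
    obtain ⟨hA1, hA2, -⟩ := List.isChain_append.1 hA
    have hperm : (P ++ (E.reverse ++ B)).Perm (A ++ B) := by
      rw [hP, List.append_assoc]
      exact List.Perm.append_left _ (List.Perm.append_right _ (List.reverse_perm E))
    refine ⟨P ++ (E.reverse ++ B), ?_, hperm.nodup_iff.2 hn, fun u => hperm.mem_iff.2 (hm u)⟩
    rw [List.isChain_append]
    refine ⟨hA1, ?_, ?_⟩
    · rw [List.isChain_append]
      refine ⟨isChain_rev hA2, hB, ?_⟩
      intro a ha b hb
      rw [List.getLast?_reverse, hEh] at ha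
      rw [hY] at hb
      simp only [Option.mem_some_iff] at ha hb
      subst ha hb; exact hYw.symm
    · intro a ha b hb
      rw [List.head?_append_of_ne_nil _ (by simpa using hE0), List.head?_reverse, hEl] at hb
      rw [hv] at ha
      simp only [Option.mem_some_iff] at ha hb
      subst ha hb; exact hXv.symm

lemma not_last {V : Type*} {H : SimpleGraph V} {A B : List V} {X Y : V}
    (hA : A.IsChain H.Adj) (hB : B.IsChain H.Adj) (hX : A.getLast? = some X)
    (hY : B.head? = some Y) (hn : (A ++ B).Nodup) (hm : ∀ v, v ∈ A ++ B) (hT : ¬ TrL H)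
    {v : V} (hv : (A ++ B).getLast? = some v) (hXv : H.Adj X v) : False := by
  apply hT
  have hB0 : B ≠ [] := by rintro rfl; simp at hY
  rw [List.getLast?_append_of_ne_nil _ hB0] at hv
  have hperm : (A ++ B.reverse).Perm (A ++ B) := List.Perm.append_left _ (List.reverse_perm B)
  refine ⟨A ++ B.reverse, ?_, hperm.nodup_iff.2 hn, fun u => hperm.mem_iff.2 (hm u)⟩
  rw [List.isChain_append]
  refine ⟨hA, isChain_rev hB, ?_⟩
  intro a ha b hb
  rw [List.head?_reverse, hv] at hb
  rw [hX] at ha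
  simp only [Option.mem_some_iff] at ha hb
  subst ha hb; exact hXv

lemma closure_count {V : Type*} [Fintype V] {H : SimpleGraph V} {A B : List V} {X Y : V} {n : ℕ}
    (L : Finset V) (hL : L.card = n)
    (hA : A.IsChain H.Adj) (hB : B.IsChain H.Adj) (hX : A.getLast? = some X)
    (hY : B.head? = some Y) (hn : (A ++ B).Nodup) (hm : ∀ v, v ∈ A ++ B) (hT : ¬ TrL H)
    (hYL : ∀ w, H.Adj Y w → w ∈ L)
    (hXL : ∀ i (hi : i + 1 < (A ++ B).length), H.Adj X ((A ++ B)[i]) → (A ++ B)[i + 1] ∈ L) :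
    H.degree X + H.degree Y ≤ n := by
  classical
  set l := A ++ B with hl
  have hlt : ∀ v, H.Adj X v → l.idxOf v + 1 < l.length := by
    intro v hv
    have h1 : l.idxOf v < l.length := List.idxOf_lt_length_of_mem (hm v)
    by_contra h2
    have h3 : l.idxOf v = l.length - 1 := by omega
    refine not_last hA hB hX hY hn hm hT (v := v) ?_ hv
    rw [← hl, List.getLast?_eq_getElem?, ← h3, List.getElem?_eq_getElem h1, List.getElem_idxOf]
  let σ : V → V := fun v => if h : l.idxOf v + 1 < l.length then l[l.idxOf v + 1] else v
  have hσ : ∀ v, (hv : H.Adj X v) → σ v = l[l.idxOf v + 1]'(hlt v hv) := by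
    intro v hv; simp only [σ]; rw [dif_pos (hlt v hv)]
  have hinj : Set.InjOn σ (H.neighborFinset X : Set V) := by
    intro a ha b hb hab
    have ha' : H.Adj X a := by simpa using ha
    have hb' : H.Adj X b := by simpa using hb
    rw [hσ a ha', hσ b hb'] at hab
    have h5 := (List.Nodup.getElem_inj_iff hn).1 hab
    have : l.idxOf a = l.idxOf b := by omega
    exact (List.idxOf_inj (hm a)).1 this
  have hsub : (H.neighborFinset X).image σ ⊆ L := by
    intro w hw
    obtain ⟨v, hv, rfl⟩ := Finset.mem_image.1 hw
    have hv' : H.Adj X v := by simpa using hv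
    rw [hσ v hv']
    apply hXL
    rw [List.getElem_idxOf]; exact hv'
  have hsub2 : H.neighborFinset Y ⊆ L := by
    intro w hw; exact hYL w (by simpa using hw)
  have hdisj : Disjoint ((H.neighborFinset X).image σ) (H.neighborFinset Y) := by
    rw [Finset.disjoint_left]
    intro w hw hw2
    obtain ⟨v, hv, rfl⟩ := Finset.mem_image.1 hw
    have hv' : H.Adj X v := by simpa using hv
    have hw2' : H.Adj Y (σ v) := by simpa using hw2
    have hlv := hlt v hv'
    refine path_rotation hA hB hX hY hn hm hT (P := l.take (l.idxOf v + 1)) (S := l.drop (l.idxOf v + 1))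
      (v := v) (w := σ v) (List.take_append_drop _ _).symm ?_ ?_ hv' hw2'
    · rw [List.getLast?_take]
      simp only [Nat.add_eq_zero_iff, one_ne_zero, and_false, if_false, Nat.add_sub_cancel]
      rw [List.getElem?_eq_getElem (by omega), List.getElem_idxOf]; rfl
    · rw [List.head?_drop, List.getElem?_eq_getElem hlv, hσ v hv']
  have := Finset.card_le_card (Finset.union_subset hsub hsub2)
  rw [Finset.card_union_of_disjoint hdisj, Finset.card_image_of_injOn hinj, hL] at this
  simpa [SimpleGraph.card_neighborFinset_eq_degree] using this

lemma closure_lem {n : ℕ} {H G' : SimpleGraph (Fin n ⊕ Fin n)} (hc : CrossOnly H)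
    {x y : Fin n} (hG' : ∀ a b, G'.Adj a b → H.Adj a b ∨ (a = Sum.inl x ∧ b = Sum.inr y) ∨
      (a = Sum.inr y ∧ b = Sum.inl x)) (hT : ¬ TrL H) (hT' : TrL G') :
    H.degree (Sum.inl x) + H.degree (Sum.inr y) ≤ n := by
  have hGc : ∀ a b, G'.Adj a b → a.isLeft = !b.isLeft := by
    intro a b hab
    rcases hG' a b hab with h | ⟨rfl, rfl⟩ | ⟨rfl, rfl⟩
    · rcases a with a | a <;> rcases b with b | b
      · exact absurd h (hc.1 _ _)
      · rfl
      · rfl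
      · exact absurd h (hc.2 _ _)
    · rfl
    · rfl
  obtain ⟨l, hch, hn, hm⟩ := hT'
  have hnc : ¬ l.IsChain H.Adj := fun h => hT ⟨l, h, hn, hm⟩
  rw [List.isChain_iff_getElem] at hnc
  push Not at hnc
  obtain ⟨i, hi, hadj⟩ := hnc
  -- reduce to splitting at x, y
  have main : ∀ l : List (Fin n ⊕ Fin n), l.IsChain G'.Adj → l.Nodup → (∀ v, v ∈ l) → ∀ i (hi : i + 1 < l.length),
      l[i] = Sum.inl x → l[i+1] = Sum.inr y → H.degree (Sum.inl x) + H.degree (Sum.inr y) ≤ n := by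
    intro l hch hn hm i hi hix hiy
    have hl : l.take (i+1) ++ l.drop (i+1) = l := List.take_append_drop _ _
    have hpair : ∀ j (hj : j + 1 < l.length), j ≠ i → H.Adj l[j] l[j+1] := by
      intro j hj hne
      rcases hG' _ _ (List.isChain_iff_getElem.1 hch j hj) with h | ⟨h1, h2⟩ | ⟨h1, h2⟩
      · exact h
      · rw [← hix] at h1
        exact absurd ((List.Nodup.getElem_inj_iff hn).1 h1) hne
      · rw [← hiy] at h1
        rw [← hix] at h2
        have e1 := (List.Nodup.getElem_inj_iff hn).1 h1
        have e2 := (List.Nodup.getElem_inj_iff hn).1 h2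
        omega
    refine closure_count (A := l.take (i+1)) (B := l.drop (i+1))
      (Finset.univ.map Function.Embedding.inl) (by simp) ?_ ?_ ?_ ?_ (by rw [hl]; exact hn)
      (by rw [hl]; exact hm) hT ?_ ?_
    · rw [List.isChain_iff_getElem]
      intro j hj
      rw [List.length_take] at hj
      rw [List.getElem_take, List.getElem_take]
      exact hpair j (by omega) (by omega)
    · rw [List.isChain_iff_getElem]
      intro j hj
      rw [List.length_drop] at hj
      rw [List.getElem_drop, List.getElem_drop]
      exact hpair (i + 1 + j) (by omega) (by omega)
    · rw [List.getLast?_take]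
      simp only [Nat.add_eq_zero_iff, one_ne_zero, and_false, if_false, Nat.add_sub_cancel]
      rw [List.getElem?_eq_getElem (by omega), hix]; rfl
    · rw [List.head?_drop, List.getElem?_eq_getElem hi, hiy]
    · intro w hw
      rcases w with w | w
      · simp
      · exact absurd hw (hc.2 _ _)
    · intro j hj h
      simp only [hl] at h hj ⊢
      have h2 := hGc _ _ (List.isChain_iff_getElem.1 hch j hj)
      rcases hlj : l[j] with a | a
      · rw [hlj] at h; exact absurd h (hc.1 _ _)
      · rw [hlj] at h2
        rcases hlj2 : l[j+1] with b | b
        · simp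
        · rw [hlj2] at h2; simp at h2
  rcases hG' _ _ (List.isChain_iff_getElem.1 hch i hi) with h | ⟨h1, h2⟩ | ⟨h1, h2⟩
  · exact absurd h hadj
  · exact main l hch hn hm i hi h1 h2
  · refine main l.reverse (isChain_rev hch) (List.nodup_reverse.2 hn) (by simpa using hm)
      (l.length - 2 - i) (by simp; omega) ?_ ?_
    · rw [List.getElem_reverse]
      rw [← h2]; congr 1; omega
    · rw [List.getElem_reverse]
      rw [← h1]; congr 1; omega

/-- Building a Hamilton path from enumerations of the two sides. -/
lemma trL_of_enum {n : ℕ} {H : SimpleGraph (Fin n ⊕ Fin n)} (f g : Fin n ≃ Fin n)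
    (h1 : ∀ i, H.Adj (Sum.inl (f i)) (Sum.inr (g i)))
    (h2 : ∀ i j : Fin n, i.val + 1 = j.val → H.Adj (Sum.inl (f j)) (Sum.inr (g i))) : TrL H := by
  let F : Fin (2 * n) → Fin n ⊕ Fin n := fun i =>
    if i.val % 2 = 0 then Sum.inl (f ⟨i.val / 2, by omega⟩) else Sum.inr (g ⟨i.val / 2, by omega⟩)
  refine ⟨List.ofFn F, ?_, ?_, ?_⟩
  · rw [List.isChain_iff_getElem]
    intro i hi
    rw [List.length_ofFn] at hi
    rw [List.getElem_ofFn, List.getElem_ofFn]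
    simp only [F]
    rcases Nat.mod_two_eq_zero_or_one i with h | h
    · have h' : ¬ (i + 1) % 2 = 0 := by omega
      rw [if_pos h, if_neg h']
      have e : (i + 1) / 2 = i / 2 := by omega
      simp only [e]
      exact h1 _
    · have h' : (i + 1) % 2 = 0 := by omega
      have h'' : ¬ i % 2 = 0 := by omega
      rw [if_neg h'', if_pos h']
      exact (h2 _ _ (by simp only; omega)).symm
  · rw [List.nodup_ofFn]
    intro a b hab
    simp only [F] at hab
    ext
    split_ifs at hab with ha hb hb
    · have := f.injective (Sum.inl_injective hab)
      simp only [Fin.mk.injEq] at this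
      omega
    · have := g.injective (Sum.inr_injective hab)
      simp only [Fin.mk.injEq] at this
      omega
  · intro v
    rw [List.mem_ofFn']
    rcases v with v | v
    · refine ⟨⟨2 * (f.symm v).val, by omega⟩, ?_⟩
      simp [F]
    · refine ⟨⟨2 * (g.symm v).val + 1, by omega⟩, ?_⟩
      have e : (2 * (g.symm v).val + 1) / 2 = (g.symm v).val := by omega
      have e2 : ¬ (2 * (g.symm v).val + 1) % 2 = 0 := by omega
      simp only [F, if_neg e2, e]
      simp

end Lists

section Rel

variable {n : ℕ}

/-- Left degree, right degree, left and right codegree of a relation. -/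
noncomputable def dL (r : Fin n → Fin n → Prop) (x : Fin n) : ℕ :=
  (Finset.univ.filter fun y => r x y).card
noncomputable def dR (r : Fin n → Fin n → Prop) (y : Fin n) : ℕ :=
  (Finset.univ.filter fun x => r x y).card
noncomputable def mL (r : Fin n → Fin n → Prop) (x : Fin n) : ℕ :=
  (Finset.univ.filter fun y => ¬ r x y).card
noncomputable def mR (r : Fin n → Fin n → Prop) (y : Fin n) : ℕ :=
  (Finset.univ.filter fun x => ¬ r x y).card

def RTr (r : Fin n → Fin n → Prop) : Prop :=
  ∃ f g : Fin n ≃ Fin n, (∀ i, r (f i) (g i)) ∧ ∀ i j : Fin n, i.val + 1 = j.val → r (f j) (g i)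

lemma dL_add (r : Fin n → Fin n → Prop) (x : Fin n) : dL r x + mL r x = n := by
  unfold dL mL
  rw [Finset.card_filter_add_card_filter_not]; simp

lemma dR_add (r : Fin n → Fin n → Prop) (x : Fin n) : dR r x + mR r x = n := by
  unfold dR mR
  rw [Finset.card_filter_add_card_filter_not]; simp

lemma equiv_ext (s : Finset (Fin n)) (φ : Fin n → Fin n) (h : Set.InjOn φ s) :
    ∃ e : Fin n ≃ Fin n, ∀ i ∈ s, e i = φ i := by
  obtain ⟨g, hg⟩ := Finset.exists_equiv_extend_of_card_eq (α := Fin n) (t := (Finset.univ : Finset (Fin n)))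
    (by simp) (s := s) (f := φ) (Finset.subset_univ _) h
  refine ⟨g.trans (Equiv.subtypeUnivEquiv (by simp)), fun i hi => ?_⟩
  have := hg i hi
  simpa using this

lemma enumW (W : Finset (Fin n)) (m : ℕ) (hW : W.card = m) (w0 : Fin n) (hw0 : w0 ∉ W) :
    ∃ e : Fin n ≃ Fin n, (∀ i : Fin n, i.val < m ↔ e i ∈ W) ∧ (∀ i : Fin n, i.val = m ↔ e i = w0) := by
  subst hW
  let φ : Fin n → Fin n := fun i => if h : i.val < W.card then (W.equivFin.symm ⟨i.val, h⟩ : Fin n) else w0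
  have hφ1 : ∀ i : Fin n, (h : i.val < W.card) → φ i = (W.equivFin.symm ⟨i.val, h⟩ : Fin n) := by
    intro i h; simp only [φ]; rw [dif_pos h]
  have hφ2 : ∀ i : Fin n, ¬ i.val < W.card → φ i = w0 := by
    intro i h; simp only [φ]; rw [dif_neg h]
  have hmem : ∀ i : Fin n, i.val < W.card → φ i ∈ W := by
    intro i h; rw [hφ1 i h]; exact Subtype.property _
  have hinj : Set.InjOn φ (Finset.univ.filter fun i : Fin n => i.val ≤ W.card : Finset (Fin n)) := by
    intro a ha b hb hab
    simp only [Finset.coe_filter, Finset.mem_univ, true_and, Set.mem_ofPred_eq] at ha hb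
    by_cases h1 : a.val < W.card <;> by_cases h2 : b.val < W.card
    · rw [hφ1 a h1, hφ1 b h2] at hab
      have := W.equivFin.symm.injective (Subtype.ext hab)
      simp only [Fin.mk.injEq] at this
      exact Fin.ext this
    · rw [hφ2 b h2] at hab
      exact absurd (hab ▸ hmem a h1) hw0
    · rw [hφ2 a h1] at hab
      exact absurd (hab.symm ▸ hmem b h2) hw0
    · ext; omega
  obtain ⟨e, he⟩ := equiv_ext _ φ hinj
  have hcard : W.card < n := by
    have := Finset.card_lt_univ_of_notMem hw0
    simpa using this
  refine ⟨e, fun i => ⟨fun h => ?_, fun h => ?_⟩, fun i => ⟨fun h => ?_, fun h => ?_⟩⟩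
  · rw [he i (by simp; omega)]; exact hmem i h
  · set j := W.equivFin ⟨e i, h⟩ with hj
    have hjn : j.val < n := by omega
    have h1 : φ ⟨j.val, hjn⟩ = e i := by
      rw [hφ1 ⟨j.val, hjn⟩ j.2]
      simp [hj]
    have h2 := he ⟨j.val, hjn⟩ (by simp)
    rw [h1] at h2
    have := e.injective h2
    rw [← this]; exact j.2
  · rw [he i (by simp; omega), hφ2 i (by omega)]
  · have h2 := he ⟨W.card, hcard⟩ (by simp)
    rw [hφ2 _ (by simp), ← h] at h2
    have := e.injective h2
    rw [← this]

lemma pathT (r : Fin n → Fin n → Prop) (Z F : Finset (Fin n)) (m : ℕ) (hZ : Z.card = m + 1)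
    (hF : F.card = m) (hc : ∀ x, x ∉ Z → ∀ y, r x y) (hZF : ∀ z ∈ Z, ∀ y ∈ F, r z y)
    (z0 y0 : Fin n) (hz0 : z0 ∈ Z) (hy0 : y0 ∉ F) (h0 : r z0 y0) : RTr r := by
  obtain ⟨f, hf1, hf2⟩ := enumW (Z.erase z0) m (by rw [Finset.card_erase_of_mem hz0]; omega) z0 (by simp)
  obtain ⟨g, hg1, hg2⟩ := enumW F m hF y0 hy0
  have hlt : ∀ i : Fin n, i.val < m → f i ∈ Z := fun i hi => Finset.mem_of_mem_erase ((hf1 i).1 hi)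
  have hgt : ∀ i : Fin n, m < i.val → f i ∉ Z := by
    intro i hi hmem
    by_cases h : f i = z0
    · have := (hf2 i).2 h; omega
    · have := (hf1 i).2 (Finset.mem_erase.2 ⟨h, hmem⟩); omega
  refine ⟨f, g, fun i => ?_, fun i j hij => ?_⟩
  · rcases lt_trichotomy i.val m with h | h | h
    · exact hZF _ (hlt i h) _ ((hg1 i).1 h)
    · rw [(hf2 i).1 h, (hg2 i).1 h]; exact h0
    · exact hc _ (hgt i h) _
  · rcases lt_trichotomy j.val m with h | h | h
    · exact hZF _ (hlt j h) _ ((hg1 i).1 (by omega))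
    · rw [(hf2 j).1 h]; exact hZF _ hz0 _ ((hg1 i).1 (by omega))
    · exact hc _ (hgt j h) _

lemma dR_split (r : Fin n → Fin n → Prop) (Z : Finset (Fin n)) (hc : ∀ x, x ∉ Z → ∀ y, r x y)
    (y : Fin n) : dR r y + Z.card = n + (Z.filter fun z => r z y).card := by
  unfold dR
  have h1 : (Finset.univ.filter fun x => r x y) = Zᶜ ∪ (Z.filter fun z => r z y) := by
    ext x
    simp only [Finset.mem_filter, Finset.mem_univ, true_and, Finset.mem_union, Finset.mem_compl]
    constructor
    · intro h; by_cases hx : x ∈ Z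
      · exact Or.inr ⟨hx, h⟩
      · exact Or.inl hx
    · rintro (h | h)
      · exact hc x h y
      · exact h.2
  have h2 : Disjoint Zᶜ (Z.filter fun z => r z y) := by
    rw [Finset.disjoint_left]; intro a ha hb
    exact (Finset.mem_compl.1 ha) (Finset.mem_filter.1 hb).1
  rw [h1, Finset.card_union_of_disjoint h2]
  have := Finset.card_add_card_compl Z
  simp only [Fintype.card_fin] at this
  omega

lemma lemT2 (r : Fin n → Fin n → Prop) (Z : Finset (Fin n)) (m : ℕ) (hZ : Z.card = m + 1)
    (hc : ∀ x, x ∉ Z → ∀ y, r x y) (hd : ∀ z ∈ Z, m ≤ dL r z) (z0 : Fin n) (hz0 : z0 ∈ Z)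
    (hd0 : m + 1 ≤ dL r z0) (hs : ∀ x y, ¬ r x y → dL r x + dR r y ≤ n) : RTr r := by
  have hA : ∀ z ∈ Z, ∀ y, r z y → r z0 y := by
    intro z hz y hzy
    by_contra h
    have h1 := hs z0 y h
    have h2 := dR_split r Z hc y
    have h3 : 0 < (Z.filter fun z => r z y).card :=
      Finset.card_pos.2 ⟨z, Finset.mem_filter.2 ⟨hz, hzy⟩⟩
    omega
  have hB : ∀ z ∈ Z, z ≠ z0 → ∀ y, r z y → ∀ z' ∈ Z, r z' y := by
    intro z hz hne y hzy z' hz'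
    by_contra h
    have h1 := hs z' y h
    have h2 := dR_split r Z hc y
    have h3 : 1 < (Z.filter fun z => r z y).card :=
      Finset.one_lt_card.2 ⟨z, Finset.mem_filter.2 ⟨hz, hzy⟩, z0,
        Finset.mem_filter.2 ⟨hz0, hA z hz y hzy⟩, hne⟩
    have h4 := hd z' hz'
    omega
  let F0 : Finset (Fin n) := Finset.univ.filter fun y => ∀ z ∈ Z, r z y
  have hF0 : m ≤ F0.card := by
    rcases Nat.eq_zero_or_pos m with h | h
    · omega
    · obtain ⟨z1, hz1, hne⟩ := Finset.exists_mem_ne (s := Z) (by omega) z0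
      refine (hd z1 hz1).trans (Finset.card_le_card ?_)
      intro y hy
      exact Finset.mem_filter.2 ⟨Finset.mem_univ _, hB z1 hz1 hne y (Finset.mem_filter.1 hy).2⟩
  obtain ⟨F, hFs, hF⟩ := Finset.exists_subset_card_eq hF0
  obtain ⟨y0, hy0, hy0'⟩ := Finset.exists_mem_notMem_of_card_lt_card (s := F)
    (t := Finset.univ.filter fun y => r z0 y) (by rw [hF]; exact hd0)
  exact pathT r Z F m hZ hF hc (fun z hz y hy => (Finset.mem_filter.1 (hFs hy)).2 z hz) z0 y0 hz0 hy0'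
    (Finset.mem_filter.1 hy0).2

lemma pathC (r : Fin n → Fin n → Prop) (hn : 2 ≤ n) (x x1 y' fv : Fin n) (hx : x ≠ x1) (hy : fv ≠ y')
    (h1 : r x fv) (h2 : r x1 y') (hc : ∀ a b, a ≠ x → b ≠ y' → r a b) : RTr r := by
  have hinj : ∀ a b : Fin n, a ≠ b → Set.InjOn (fun i : Fin n => if i.val = 0 then a else b)
      (Finset.univ.filter fun i : Fin n => i.val = 0 ∨ i.val = n - 1 : Finset (Fin n)) := by
    intro a b hab i hi j hj hij
    simp only [Finset.coe_filter, Finset.mem_univ, true_and, Set.mem_ofPred_eq] at hi hj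
    simp only at hij
    ext
    split_ifs at hij with h1 h2 h2
    · omega
    · exact absurd hij hab
    · exact absurd hij.symm hab
    · omega
  obtain ⟨f, hf⟩ := equiv_ext _ _ (hinj x x1 hx)
  obtain ⟨g, hg⟩ := equiv_ext _ _ (hinj fv y' hy)
  have hf0 : ∀ i : Fin n, i.val = 0 ↔ f i = x := by
    intro i
    have h0 := hf ⟨0, by omega⟩ (by simp)
    simp only [if_true] at h0
    constructor
    · intro hi; rw [← h0]; congr 1; ext; exact hi
    · intro h; rw [← h0] at h; have := f.injective h; rw [this]
  have hg1 : ∀ i : Fin n, i.val = n - 1 ↔ g i = y' := by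
    intro i
    have h0 := hg ⟨n - 1, by omega⟩ (by simp)
    rw [if_neg (by simp only; omega)] at h0
    constructor
    · intro hi; rw [← h0]; congr 1; ext; exact hi
    · intro h; rw [← h0] at h; have := g.injective h; rw [this]
  refine ⟨f, g, fun i => ?_, fun i j hij => ?_⟩
  · by_cases h0 : i.val = 0
    · have e1 := hg i (by simp [h0])
      rw [if_pos h0] at e1
      rw [(hf0 i).1 h0, e1]; exact h1
    · by_cases hl : i.val = n - 1
      · have e1 := hf i (by simp [hl])
        rw [if_neg h0] at e1
        rw [(hg1 i).1 hl, e1]; exact h2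
      · exact hc _ _ (fun h => h0 ((hf0 i).2 h)) (fun h => hl ((hg1 i).2 h))
  · refine hc _ _ (fun h => ?_) (fun h => ?_)
    · have := (hf0 j).2 h; omega
    · have := (hg1 i).2 h; omega

/-- Counting lemma. -/
lemma count1 (r : Fin n → Fin n → Prop) (Z : Finset (Fin n))
    (hs : ∀ x y, ¬ r x y → dL r x + dR r y ≤ n) (y : Fin n) :
    (Zᶜ.filter fun x => ¬ r x y).card * n ≤ ∑ x ∈ Zᶜ, mL r x +
      (Zᶜ.filter fun x => ¬ r x y).card * (Z.card + (Zᶜ.filter fun x => ¬ r x y).card) := by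
  set T := Zᶜ.filter fun x => ¬ r x y with hT
  have h1 : mR r y ≤ Z.card + T.card := by
    unfold mR
    refine (Finset.card_le_card (t := Z ∪ T) ?_).trans (Finset.card_union_le _ _)
    intro x hx
    by_cases hz : x ∈ Z
    · exact Finset.mem_union_left _ hz
    · exact Finset.mem_union_right _ (Finset.mem_filter.2 ⟨Finset.mem_compl.2 hz, (Finset.mem_filter.1 hx).2⟩)
  have h2 : ∑ x ∈ T, n ≤ ∑ x ∈ T, (mL r x + (Z.card + T.card)) := by
    apply Finset.sum_le_sum
    intro x hx
    have e1 := hs x y (Finset.mem_filter.1 hx).2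
    have e2 := dL_add r x
    have e3 := dR_add r y
    omega
  rw [Finset.sum_add_distrib, Finset.sum_const, Finset.sum_const, smul_eq_mul, smul_eq_mul] at h2
  have h3 : ∑ x ∈ T, mL r x ≤ ∑ x ∈ Zᶜ, mL r x :=
    Finset.sum_le_sum_of_subset (Finset.filter_subset _ _)
  omega

lemma sum_out (r : Fin n → Fin n → Prop) (Z : Finset (Fin n)) :
    ∑ x ∈ Zᶜ, mL r x = ∑ y, (Zᶜ.filter fun x => ¬ r x y).card := by
  unfold mL
  simp only [Finset.card_filter]
  exact Finset.sum_comm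

lemma arith1 (k s p : ℕ) (h1 : k + 2 ≤ s) (h2 : s ≤ p) (hn : (k + 2) ^ 2 ≤ s + p) :
    (s + p) * (k + 1) ≤ s * p := by
  obtain ⟨a, rfl⟩ := Nat.exists_eq_add_of_le h1
  obtain ⟨b, rfl⟩ := Nat.exists_eq_add_of_le (h1.trans h2)
  nlinarith [Nat.zero_le (a * b)]

set_option maxHeartbeats 4000000 in
theorem structS (r : Fin n → Fin n → Prop) (k : ℕ) (hn : (k + 2) ^ 2 ≤ n)
    (hdL : ∀ x, k ≤ dL r x) (hdR : ∀ y, k ≤ dR r y)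
    (hs : ∀ x y, ¬ r x y → dL r x + dR r y ≤ n)
    (hM : ∑ x, mL r x ≤ n * (k + 1)) (hM' : 1 ≤ k → ∑ x, mL r x < n * (k + 1))
    (hT : ¬ RTr r) (x y : Fin n) (hxy : ¬ r x y) (hle : dL r x ≤ dR r y)
    (hmax : ∀ x' y', ¬ r x' y' → dL r x' + dR r y' ≤ dL r x + dR r y) :
    (∃ Z : Finset (Fin n), Z.card = k + 1 ∧ ∀ z ∈ Z, dL r z = k) ∨
    (k = 1 ∧ ∃ x0 y0, ∀ a b, r a b → (a = x0 ↔ b = y0)) := by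
  set s := dL r x with hs_def
  clear_value s
  set Z : Finset (Fin n) := Finset.univ.filter fun x' => ¬ r x' y with hZdef
  have hZcard : dR r y + Z.card = n := dR_add r y
  have hxZ : x ∈ Z := by simp [hZdef, hxy]
  have hZs : ∀ z ∈ Z, dL r z ≤ s := by
    intro z hz
    have := hmax z y (Finset.mem_filter.1 hz).2
    omega
  have hst := hs x y hxy
  have hks : k ≤ s := by rw [hs_def]; exact hdL x
  have hsn : 2 * s ≤ n := by omega
  have hcs : s ≤ Z.card := by omega
  have hsplit : ∑ x ∈ Z, mL r x + ∑ x ∈ Zᶜ, mL r x = ∑ x, mL r x := Finset.sum_add_sum_compl Z _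
  have hZsum : Z.card * (n - s) ≤ ∑ x ∈ Z, mL r x := by
    rw [← smul_eq_mul, ← Finset.sum_const]
    apply Finset.sum_le_sum
    intro z hz
    have := hZs z hz
    have := dL_add r z
    omega
  obtain ⟨p, hp⟩ : ∃ p, n = s + p := ⟨n - s, by omega⟩
  have hnp : n - s = p := by omega
  rw [hnp] at hZsum
  have hsp : s ≤ p := by omega
  rcases Nat.lt_or_ge s (k + 2) with hs2 | hs2
  swap
  · -- s ≥ k + 2
    exfalso
    have e1 : s * p ≤ Z.card * p := Nat.mul_le_mul_right _ hcs
    have e2 : n * (k + 1) ≤ s * p := by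
      have := arith1 k s p hs2 hsp (by omega)
      have e : n * (k + 1) = (s + p) * (k + 1) := congrArg (· * (k + 1)) hp
      omega
    rcases Nat.eq_zero_or_pos k with hk | hk
    · have hp0 : 0 < p := by omega
      have f1 : ∑ x ∈ Zᶜ, mL r x = 0 := by omega
      have f2 : Z.card = s := by
        have : Z.card * p ≤ s * p := by omega
        exact le_antisymm (Nat.le_of_mul_le_mul_right this hp0) hcs
      have f3 : ∑ x ∈ Z, mL r x = ∑ x ∈ Z, p := by
        rw [Finset.sum_const, smul_eq_mul]; omega
      have f4 : ∀ z ∈ Z, dL r z = s := by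
        intro z hz
        have hle : ∀ i ∈ Z, p ≤ mL r i := by
          intro i hi
          have := hZs i hi
          have := dL_add r i
          omega
        have := (Finset.sum_eq_sum_iff_of_le hle).1 f3.symm z hz
        have := dL_add r z
        omega
      have f5 : ∀ x, x ∉ Z → ∀ y, r x y := by
        intro x hx y
        by_contra h
        have := (Finset.sum_eq_zero_iff.1 f1) x (Finset.mem_compl.2 hx)
        unfold mL at this
        rw [Finset.card_eq_zero, Finset.filter_eq_empty_iff] at this
        exact this (Finset.mem_univ y) h
      exact hT (lemT2 r Z (s - 1) (by omega) f5 (fun z hz => by have := f4 z hz; omega) x hxZ (by omega) hs)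
    · have := hM' hk
      omega
  -- s ∈ {k, k+1}
  have hcomplete : ∀ Z : Finset (Fin n), (∀ y, (Zᶜ.filter fun x => ¬ r x y).card = 0) →
      ∀ x, x ∉ Z → ∀ y, r x y := by
    intro Z h x hx y
    by_contra hh
    have := h y
    rw [Finset.card_eq_zero] at this
    have h2 : x ∈ Zᶜ.filter fun x => ¬ r x y := Finset.mem_filter.2 ⟨Finset.mem_compl.2 hx, hh⟩
    rw [this] at h2
    simp at h2
  have htle : ∀ (Z : Finset (Fin n)) y, (Zᶜ.filter fun x => ¬ r x y).card ≤ ∑ x ∈ Zᶜ, mL r x := by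
    intro Z y
    rw [sum_out]
    exact Finset.single_le_sum (f := fun y => (Zᶜ.filter fun x => ¬ r x y).card) (fun _ _ => Nat.zero_le _) (Finset.mem_univ y)
  rcases Nat.lt_or_ge s (k + 1) with hs1 | hs1
  swap
  · -- s = k + 1
    exfalso
    have hsk : s = k + 1 := by omega
    have hZc : Z.card = k + 1 := by
      by_contra hne
      have h2 : (k + 2) * p ≤ Z.card * p := Nat.mul_le_mul_right _ (by omega)
      have hM3 : ∑ x, mL r x ≤ ((k + 1) + p) * (k + 1) := by
        have e : n * (k + 1) = ((k + 1) + p) * (k + 1) := congrArg (· * (k + 1)) (by omega : n = (k + 1) + p)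
        omega
      have hn3 : (k + 2) ^ 2 ≤ (k + 1) + p := by omega
      have hn4 : (k + 2) * p ≤ ((k + 1) + p) * (k + 1) := by omega
      clear * - hn3 hn4
      nlinarith
    have hout : ∑ x ∈ Zᶜ, mL r x ≤ (k + 1) ^ 2 := by
      rw [hZc] at hZsum
      have hM3 : ∑ x, mL r x ≤ ((k + 1) + p) * (k + 1) := by
        have e : n * (k + 1) = ((k + 1) + p) * (k + 1) := congrArg (· * (k + 1)) (by omega : n = (k + 1) + p)
        omega
      have hn3 : (k + 2) ^ 2 ≤ (k + 1) + p := by omega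
      nlinarith
    have hz0 : ∀ y, (Zᶜ.filter fun x => ¬ r x y).card = 0 := by
      intro y'
      by_contra hne
      have c1 := count1 r Z hs y'
      have c2 := htle Z y'
      set t := (Zᶜ.filter fun x => ¬ r x y').card
      rw [hZc] at c1
      have ht1 : 1 ≤ t := by omega
      obtain ⟨u, hu⟩ : ∃ u, n = (k + 1) + 1 + t + u := ⟨n - ((k + 1) + 1 + t), by
        have : t ≤ (k+1)^2 := c2.trans hout
        have : (k+1)+1+t ≤ n := by nlinarith
        omega⟩
      obtain ⟨t', ht'⟩ := Nat.exists_eq_add_of_le ht1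
      have c3 : t * (u + 1) ≤ (k + 1) ^ 2 := by
        have : t * n = t * (k + 1 + t) + t * (u + 1) := by rw [hu]; ring
        omega
      rw [ht'] at c3 hu
      nlinarith [Nat.zero_le (t' * u)]
    exact hT (lemT2 r Z k hZc (hcomplete Z hz0) (fun z _ => hdL z) x hxZ (by omega) hs)
  have hsk : s = k := by omega
  have hZdeg : ∀ z ∈ Z, dL r z = k := fun z hz => le_antisymm (hsk ▸ hZs z hz) (hdL z)
  have hZle : Z.card ≤ k + 1 := by
    by_contra hne
    have h2 : (k + 2) * p ≤ Z.card * p := Nat.mul_le_mul_right _ (by omega)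
    have hM3 : ∑ x, mL r x ≤ (k + p) * (k + 1) := by
      have e : n * (k + 1) = (k + p) * (k + 1) := congrArg (· * (k + 1)) (by omega : n = k + p)
      omega
    have hn3 : (k + 2) ^ 2 ≤ k + p := by omega
    have hn4 : (k + 2) * p ≤ (k + p) * (k + 1) := by omega
    clear * - hn3 hn4
    nlinarith
  rcases Nat.lt_or_ge Z.card (k + 1) with hZ1 | hZ1
  swap
  · exact Or.inl ⟨Z, by omega, hZdeg⟩
  have hZc : Z.card = k := by omega
  have hk : 1 ≤ k := by
    have : 0 < Z.card := Finset.card_pos.2 ⟨x, hxZ⟩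
    omega
  have hM2 := hM' hk
  have hout : ∑ x ∈ Zᶜ, mL r x + 1 ≤ n + k ^ 2 := by
    rw [hZc] at hZsum
    have hM3 : ∑ x, mL r x < (k + p) * (k + 1) := by
      have e : n * (k + 1) = (k + p) * (k + 1) := congrArg (· * (k + 1)) (by omega : n = k + p)
      omega
    have hn3 : (k + 2) ^ 2 ≤ k + p := by omega
    have hnk : n = k + p := by omega
    nlinarith
  have hdich : ∀ y', (Zᶜ.filter fun x => ¬ r x y').card ≤ 1 ∨ n ≤ (Zᶜ.filter fun x => ¬ r x y').card + k + 1 := by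
    intro y'
    by_contra hne
    push Not at hne
    have c1 := count1 r Z hs y'
    set t := (Zᶜ.filter fun x => ¬ r x y').card
    rw [hZc] at c1
    obtain ⟨h1, h2⟩ := hne
    obtain ⟨u, hu⟩ : ∃ u, n = t + k + 2 + u := ⟨n - (t + k + 2), by omega⟩
    obtain ⟨t', ht'⟩ : ∃ t', t = 2 + t' := ⟨t - 2, by omega⟩
    have c3 : t * (u + 2) ≤ ∑ x ∈ Zᶜ, mL r x := by
      have : t * n = t * (k + t) + t * (u + 2) := by rw [hu]; ring
      omega
    rw [ht'] at c3 hu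
    nlinarith [Nat.zero_le (t' * u)]
  by_cases hone : ∃ y', (Zᶜ.filter fun x => ¬ r x y').card = 1
  · -- one special row
    obtain ⟨y', hy'⟩ := hone
    obtain ⟨x', hx'⟩ := Finset.card_eq_one.1 hy'
    have hx'm : x' ∈ Zᶜ.filter fun x => ¬ r x y' := by rw [hx']; simp
    obtain ⟨hx'Z, hx'r⟩ := Finset.mem_filter.1 hx'm
    have rowbig : ∀ y'', (Zᶜ.filter fun x => ¬ r x y'').card = 1 → ∀ x'' ∈ Zᶜ, ¬ r x'' y'' →
        n ≤ mL r x'' + k + 1 := by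
      intro y'' h1 x'' h2 h3
      have c1 := hs x'' y'' h3
      have c2 := dL_add r x''
      have c3 := dR_add r y''
      have c4 : mR r y'' ≤ k + 1 := by
        unfold mR
        rw [← hZc, ← h1]
        refine (Finset.card_le_card (t := Z ∪ _) ?_).trans (Finset.card_union_le _ _)
        intro a ha
        by_cases hz : a ∈ Z
        · exact Finset.mem_union_left _ hz
        · exact Finset.mem_union_right _ (Finset.mem_filter.2 ⟨Finset.mem_compl.2 hz, (Finset.mem_filter.1 ha).2⟩)
      omega
    have hbig := rowbig y' hy' x' hx'Z hx'r
    have hrest : ∀ x'', x'' ∉ insert x' Z → ∀ y'', r x'' y'' := by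
      intro x'' hx'' y''
      by_contra hr
      simp only [Finset.mem_insert, not_or] at hx''
      obtain ⟨hne, hnz⟩ := hx''
      have hnz' : x'' ∈ Zᶜ := Finset.mem_compl.2 hnz
      have hpos : 0 < (Zᶜ.filter fun x => ¬ r x y'').card :=
        Finset.card_pos.2 ⟨x'', Finset.mem_filter.2 ⟨hnz', hr⟩⟩
      rcases hdich y'' with h | h
      · have hb2 := rowbig y'' (by omega) x'' hnz' hr
        have : ∑ a ∈ ({x', x''} : Finset (Fin n)), mL r a ≤ ∑ x ∈ Zᶜ, mL r x := by
          apply Finset.sum_le_sum_of_subset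
          intro a ha
          simp only [Finset.mem_insert, Finset.mem_singleton] at ha
          rcases ha with rfl | rfl
          · exact hx'Z
          · exact hnz'
        rw [Finset.sum_pair (Ne.symm hne)] at this
        nlinarith
      · have : mL r x' + ((Zᶜ.filter fun x => ¬ r x y'').card - 1) ≤ ∑ x ∈ Zᶜ, mL r x := by
          rw [← Finset.add_sum_erase _ _ hx'Z]
          apply Nat.add_le_add_left
          refine (Finset.pred_card_le_card_erase (a := x')).trans ?_
          rw [Finset.card_eq_sum_ones]
          calc ∑ a ∈ (Zᶜ.filter fun x => ¬ r x y'').erase x', 1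
              ≤ ∑ a ∈ (Zᶜ.filter fun x => ¬ r x y'').erase x', mL r a := by
                apply Finset.sum_le_sum
                intro a ha
                have := (Finset.mem_filter.1 (Finset.mem_of_mem_erase ha)).2
                exact Finset.card_pos.2 ⟨y'', Finset.mem_filter.2 ⟨Finset.mem_univ _, this⟩⟩
            _ ≤ _ := Finset.sum_le_sum_of_subset (Finset.erase_subset_erase _ (Finset.filter_subset _ _))
        have h5 : 2 * n ≤ ∑ x ∈ Zᶜ, mL r x + 2 * k + 3 := by omega
        nlinarith
    have hins : (insert x' Z).card = k + 1 := by
      rw [Finset.card_insert_of_notMem (Finset.mem_compl.1 hx'Z), hZc]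
    have hdx' : dL r x' ≤ k + 1 := by
      have := dL_add r x'; omega
    have hdx'2 := hdL x'
    rcases Nat.lt_or_ge (dL r x') (k + 1) with h | h
    · left
      refine ⟨insert x' Z, hins, fun z hz => ?_⟩
      rcases Finset.mem_insert.1 hz with rfl | hz
      · omega
      · exact hZdeg z hz
    · exact absurd (lemT2 r (insert x' Z) k hins hrest (fun z _ => hdL z) x'
        (Finset.mem_insert_self _ _) h hs) hT
  · push Not at hone
    by_cases hzero : ∀ y', (Zᶜ.filter fun x => ¬ r x y').card = 0
    · exact absurd (lemT2 r Z (k - 1) (by omega) (hcomplete Z hzero)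
        (fun z _ => by have := hdL z; omega) x hxZ (by omega) hs) hT
    · push Not at hzero
      obtain ⟨y', hy'⟩ := hzero
      have hbig : n ≤ (Zᶜ.filter fun x => ¬ r x y').card + k + 1 := by
        have := hdich y'
        have := hone y'
        omega
      have hothers : ∀ y'', y'' ≠ y' → ∀ x'', x'' ∉ Z → r x'' y'' := by
        intro y'' hne x'' hx''
        by_contra hr
        have hpos : 0 < (Zᶜ.filter fun x => ¬ r x y'').card :=
          Finset.card_pos.2 ⟨x'', Finset.mem_filter.2 ⟨Finset.mem_compl.2 hx'', hr⟩⟩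
        have hb2 : n ≤ (Zᶜ.filter fun x => ¬ r x y'').card + k + 1 := by
          have := hdich y''
          have := hone y''
          omega
        have : ∑ a ∈ ({y', y''} : Finset (Fin n)), (Zᶜ.filter fun x => ¬ r x a).card ≤ ∑ x ∈ Zᶜ, mL r x := by
          rw [sum_out]
          exact Finset.sum_le_sum_of_subset (Finset.subset_univ _)
        rw [Finset.sum_pair (Ne.symm hne)] at this
        nlinarith
      obtain ⟨x', hx'⟩ := Finset.card_pos.1 (Nat.pos_of_ne_zero hy')
      obtain ⟨hx'Z, hx'r⟩ := Finset.mem_filter.1 hx'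
      have hmx' : mL r x' ≤ 1 := by
        unfold mL
        rw [Finset.card_le_one]
        intro a ha b hb
        have h1 : a = y' := by
          by_contra h; exact (Finset.mem_filter.1 ha).2 (hothers a h x' (Finset.mem_compl.1 hx'Z))
        have h2 : b = y' := by
          by_contra h; exact (Finset.mem_filter.1 hb).2 (hothers b h x' (Finset.mem_compl.1 hx'Z))
        rw [h1, h2]
      have c1 := hs x' y' hx'r
      have c2 := dL_add r x'
      have c3 := hdR y'
      have hk1 : k = 1 := by omega
      have hdy : dR r y' = 1 := by omega
      obtain ⟨w, hw⟩ := Finset.card_eq_one.1 hdy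
      have hw' : ∀ a, r a y' ↔ a = w := by
        intro a
        have : a ∈ (Finset.univ.filter fun x => r x y') ↔ a ∈ ({w} : Finset (Fin n)) := by rw [hw]
        simpa only [Finset.mem_filter, Finset.mem_univ, true_and, Finset.mem_singleton] using this
      have hdx : dL r x = 1 := by rw [← hs_def]; omega
      obtain ⟨fv, hfv⟩ := Finset.card_eq_one.1 hdx
      have hfv' : ∀ b, r x b ↔ b = fv := by
        intro b
        have : b ∈ (Finset.univ.filter fun y => r x y) ↔ b ∈ ({fv} : Finset (Fin n)) := by rw [hfv]
        simpa only [Finset.mem_filter, Finset.mem_univ, true_and, Finset.mem_singleton] using this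
      have hZx : ∀ z, z ∈ Z → z = x := by
        have : Z.card ≤ 1 := by omega
        intro z hz
        exact Finset.card_le_one.1 this z hz x hxZ
      by_cases hwx : w = x
      · right
        refine ⟨hk1, x, y', fun a b hab => ⟨?_, ?_⟩⟩
        · rintro rfl
          have e1 : r a y' := (hw' a).2 hwx.symm
          rw [(hfv' b).1 hab, (hfv' y').1 e1]
        · rintro rfl
          rw [(hw' a).1 hab, hwx]
      · exfalso
        apply hT
        have hn2 : 2 ≤ n := by nlinarith
        refine pathC r hn2 x w y' fv (Ne.symm hwx) ?_ ((hfv' fv).2 rfl) ((hw' w).2 rfl) ?_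
        · rintro rfl
          exact hwx ((hw' x).1 ((hfv' fv).2 rfl)).symm
        · intro a b ha hb
          exact hothers b hb a (fun h => ha (hZx a h))

end Rel

section Spec

variable {n : ℕ}

/-- The cross relation of a graph on two parts. -/
def crossR (G : SimpleGraph (Fin n ⊕ Fin n)) : Fin n → Fin n → Prop :=
  fun x y => G.Adj (Sum.inl x) (Sum.inr y)

lemma sum_adj_inl {G : SimpleGraph (Fin n ⊕ Fin n)} (hc : CrossOnly G) (x : Fin n)
    (f : Fin n ⊕ Fin n → ℝ) :
    (∑ b, if G.Adj (Sum.inl x) b then f b else 0) =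
      ∑ y, if crossR G x y then f (Sum.inr y) else 0 := by
  rw [Fintype.sum_sum_type]
  have : (∑ a, if G.Adj (Sum.inl x) (Sum.inl a) then f (Sum.inl a) else 0) = 0 :=
    Finset.sum_eq_zero fun a _ => if_neg (hc.1 x a)
  rw [this, zero_add]
  rfl

lemma sum_adj_inr {G : SimpleGraph (Fin n ⊕ Fin n)} (hc : CrossOnly G) (y : Fin n)
    (f : Fin n ⊕ Fin n → ℝ) :
    (∑ b, if G.Adj (Sum.inr y) b then f b else 0) =
      ∑ x, if crossR G x y then f (Sum.inl x) else 0 := by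
  rw [Fintype.sum_sum_type]
  have : (∑ a, if G.Adj (Sum.inr y) (Sum.inr a) then f (Sum.inr a) else 0) = 0 :=
    Finset.sum_eq_zero fun a _ => if_neg (hc.2 y a)
  rw [this, add_zero]
  refine Finset.sum_congr rfl fun a _ => ?_
  have : G.Adj (Sum.inr y) (Sum.inl a) ↔ crossR G a y := G.adj_comm _ _
  simp only [this]

lemma deg_sum {V : Type*} [Fintype V] [DecidableEq V] (G : SimpleGraph V) (a : V) :
    (G.degree a : ℝ) = ∑ b, if G.Adj a b then (1 : ℝ) else 0 := by
  rw [Finset.sum_boole, ← G.card_neighborFinset_eq_degree, G.neighborFinset_eq_filter]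

lemma deg_inl {G : SimpleGraph (Fin n ⊕ Fin n)} (hc : CrossOnly G) (x : Fin n) :
    G.degree (Sum.inl x) = dL (crossR G) x := by
  have h := deg_sum G (Sum.inl x)
  rw [sum_adj_inl hc x (fun _ => 1), Finset.sum_boole] at h
  exact_mod_cast h

lemma deg_inr {G : SimpleGraph (Fin n ⊕ Fin n)} (hc : CrossOnly G) (x : Fin n) :
    G.degree (Sum.inr x) = dR (crossR G) x := by
  have h := deg_sum G (Sum.inr x)
  rw [sum_adj_inr hc x (fun _ => 1), Finset.sum_boole] at h
  exact_mod_cast h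

lemma mv_inl {G : SimpleGraph (Fin n ⊕ Fin n)} (hc : CrossOnly G) (v : Fin n ⊕ Fin n → ℝ) (x : Fin n) :
    (signlessLaplacian G).mulVec v (Sum.inl x) =
      ∑ y, if crossR G x y then v (Sum.inl x) + v (Sum.inr y) else 0 := by
  rw [sl_mulVec, sum_adj_inl hc x (fun b => v (Sum.inl x) + v b)]

lemma mv_inr {G : SimpleGraph (Fin n ⊕ Fin n)} (hc : CrossOnly G) (v : Fin n ⊕ Fin n → ℝ) (y : Fin n) :
    (signlessLaplacian G).mulVec v (Sum.inr y) =
      ∑ x, if crossR G x y then v (Sum.inl x) + v (Sum.inr y) else 0 := by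
  rw [sl_mulVec, sum_adj_inr hc y (fun b => v (Sum.inr y) + v b)]
  simp only [add_comm]

lemma form_eq {G : SimpleGraph (Fin n ⊕ Fin n)} (hc : CrossOnly G) (v : Fin n ⊕ Fin n → ℝ) :
    dotProduct v ((signlessLaplacian G).mulVec v) =
      ∑ x, ∑ y, if crossR G x y then (v (Sum.inl x) + v (Sum.inr y)) ^ 2 else 0 := by
  unfold dotProduct
  rw [Fintype.sum_sum_type]
  simp only [mv_inl hc, mv_inr hc, Finset.mul_sum]
  rw [Finset.sum_comm (f := fun (i : Fin n) (j : Fin n) => v (Sum.inr i) * _), ← Finset.sum_add_distrib]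
  refine Finset.sum_congr rfl fun x _ => ?_
  rw [← Finset.sum_add_distrib]
  refine Finset.sum_congr rfl fun y _ => ?_
  split_ifs <;> ring

lemma qSpec_ub {G : SimpleGraph (Fin n ⊕ Fin n)} (hc : CrossOnly G) (hn : 0 < n) :
    qSpec G ≤ n + (∑ x, (dL (crossR G) x : ℝ)) / n := by
  have : Nonempty (Fin n ⊕ Fin n) := ⟨Sum.inl ⟨0, hn⟩⟩
  have hnr : (0 : ℝ) < n := by exact_mod_cast hn
  set e : ℝ := ∑ x, (dL (crossR G) x : ℝ) with he
  have he' : e = ∑ y, (dR (crossR G) y : ℝ) := by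
    rw [he]
    unfold dL dR
    simp only [Finset.card_filter, Nat.cast_sum]
    exact Finset.sum_comm
  have he0 : 0 ≤ e := Finset.sum_nonneg fun _ _ => Nat.cast_nonneg _
  have key : ∀ d S : ℝ, d ≤ n → 0 ≤ d → S ≤ e → S ≤ n * d → S ≤ (n + e / n - d) * d := by
    intro d S h1 h2 h3 h4
    have : n * S ≤ n * ((n + e / n - d) * d) := by
      have e1 : n * ((n + e / n - d) * d) = n * (n - d) * d + e * d := by field_simp; ring
      rw [e1]
      nlinarith [mul_nonneg (sub_nonneg.2 h1) (sub_nonneg.2 h4), mul_nonneg h2 (sub_nonneg.2 h3)]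
    exact le_of_mul_le_mul_left this hnr
  have gen : ∀ (p : Fin n → Prop) (f : Fin n → ℕ) (d : ℕ), d = (Finset.univ.filter p).card →
      (∀ i, f i ≤ n) → (∑ i, (f i : ℝ)) = e →
      (∑ i, if p i then (f i : ℝ) else 0) ≤ (n + e / n - d) * d := by
    intro p f d hd hf hfe
    apply key
    · rw [hd]
      have := Finset.card_le_univ (Finset.univ.filter p)
      simp only [Fintype.card_fin] at this
      exact_mod_cast this
    · positivity
    · rw [← hfe]
      refine Finset.sum_le_sum fun i _ => ?_
      split_ifs
      · exact le_rfl
      · positivity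
    · rw [hd, Finset.card_filter, Nat.cast_sum, Finset.mul_sum]
      refine Finset.sum_le_sum fun i _ => ?_
      split_ifs
      · have := hf i
        simp only [Nat.cast_one, mul_one]; exact_mod_cast this
      · simp
  apply qSpec_le
  · positivity
  · rintro (x | y)
    · rw [sum_adj_inl hc x (fun b => (G.degree b : ℝ))]
      simp only [deg_inr hc, deg_inl hc]
      apply gen _ _ _ rfl
      · intro i; have := dR_add (crossR G) i; omega
      · exact he'.symm
    · rw [sum_adj_inr hc y (fun b => (G.degree b : ℝ))]
      simp only [deg_inr hc, deg_inl hc]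
      apply gen _ _ _ rfl
      · intro i; have := dL_add (crossR G) i; omega
      · exact he.symm

lemma Qgraph_cross (n k : ℕ) : CrossOnly (Qgraph n k) := by
  constructor <;> intro x y h <;> simp [Qgraph] at h

lemma Qgraph_adj (n k : ℕ) (x y : Fin n) :
    crossR (Qgraph n k) x y ↔ (x.val < k ∨ y.val < n - k - 1) := by
  simp [crossR, Qgraph]

lemma sum_fin_lt (n a : ℕ) (h : a ≤ n) (c d : ℝ) :
    (∑ i : Fin n, if i.val < a then c else d) = a * c + (n - a) * d := by
  rw [Fin.sum_univ_eq_sum_range (fun i => if i < a then c else d) n]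
  obtain ⟨b, rfl⟩ := Nat.exists_eq_add_of_le h
  rw [Finset.sum_range_add]
  have h1 : ∀ i ∈ Finset.range a, (if i < a then c else d) = c := fun i hi =>
    if_pos (Finset.mem_range.1 hi)
  rw [Finset.sum_congr rfl h1]
  simp

lemma qSpec_Q_lb (n k : ℕ) (hn : (k + 2) ^ 2 ≤ n) :
    (2 * n - k - 1 : ℝ) ≤ qSpec (Qgraph n k) ∧ (1 ≤ k → (2 * n - k - 1 : ℝ) < qSpec (Qgraph n k)) := by
  obtain ⟨a, ha⟩ : ∃ a, n = a + k + 1 := ⟨n - k - 1, by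
    have : k + 2 ≤ (k + 2) ^ 2 := by nlinarith
    omega⟩
  have hapos : 0 < a := by nlinarith
  have hna : n - k - 1 = a := by omega
  have hnr : (n : ℝ) = a + k + 1 := by exact_mod_cast ha
  have har : (0 : ℝ) < a := by exact_mod_cast hapos
  have hkr : (0 : ℝ) ≤ k := by positivity
  let v : Fin n ⊕ Fin n → ℝ := Sum.elim (fun _ => (a : ℝ)) (fun y => if y.val < a then (n : ℝ) else 0)
  have h1 := rayleigh (Qgraph n k) v
  have hnorm : dotProduct v v = n * a * (n + a) := by
    unfold dotProduct
    rw [Fintype.sum_sum_type]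
    have : ∀ y : Fin n, v (Sum.inr y) * v (Sum.inr y) = if y.val < a then (n : ℝ) * n else 0 := by
      intro y; simp only [v, Sum.elim_inr]; split_ifs <;> simp
    simp only [this]
    rw [sum_fin_lt n a (by omega)]
    simp only [v, Sum.elim_inl, Finset.sum_const, Finset.card_univ, Fintype.card_fin, nsmul_eq_mul]
    ring
  have hform : dotProduct v ((signlessLaplacian (Qgraph n k)).mulVec v) =
      n * a * (a + n) ^ 2 + k * (k + 1) * a ^ 2 := by
    rw [form_eq (Qgraph_cross n k)]
    have : ∀ x : Fin n, (∑ y, if crossR (Qgraph n k) x y then (v (Sum.inl x) + v (Sum.inr y)) ^ 2 else 0)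
        = if x.val < k then (a * (a + n : ℝ) ^ 2 + (n - a) * (a : ℝ) ^ 2) else a * (a + n : ℝ) ^ 2 := by
      intro x
      simp only [Qgraph_adj, hna, v, Sum.elim_inl, Sum.elim_inr]
      by_cases hx : x.val < k
      · rw [if_pos hx, ← sum_fin_lt n a (by omega)]
        refine Finset.sum_congr rfl fun y _ => ?_
        by_cases hy : y.val < a <;> simp [hx, hy]
      · rw [if_neg hx]
        have := sum_fin_lt n a (by omega) ((a + n : ℝ) ^ 2) 0
        rw [mul_zero, add_zero] at this
        rw [← this]
        refine Finset.sum_congr rfl fun y _ => ?_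
        by_cases hy : y.val < a <;> simp [hx, hy]
    simp only [this]
    rw [sum_fin_lt n k (by omega), hnr]
    ring
  rw [hnorm, hform] at h1
  have hN : (0 : ℝ) < n * a * (n + a) := by rw [hnr]; positivity
  have e1 : (2 * n - k - 1 : ℝ) * (n * a * (n + a)) = n * a * (a + n) ^ 2 := by rw [hnr]; ring
  constructor
  · refine le_of_mul_le_mul_right ?_ hN
    rw [e1]
    have : (0 : ℝ) ≤ k * (k + 1) * a ^ 2 := by positivity
    linarith
  · intro hk
    refine lt_of_mul_lt_mul_right ?_ hN.le
    rw [e1]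
    have hk' : (0 : ℝ) < k := by exact_mod_cast hk
    have : (0 : ℝ) < k * (k + 1) * a ^ 2 := by positivity
    linarith

lemma missing_bound {G : SimpleGraph (Fin n ⊕ Fin n)} (k : ℕ) (hc : CrossOnly G) (hn : (k + 2) ^ 2 ≤ n)
    (hq : qSpec (Qgraph n k) ≤ qSpec G) :
    ∑ x, mL (crossR G) x ≤ n * (k + 1) ∧ (1 ≤ k → ∑ x, mL (crossR G) x < n * (k + 1)) := by
  have hn0 : 0 < n := lt_of_lt_of_le (by positivity) hn
  have hnr : (0 : ℝ) < n := by exact_mod_cast hn0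
  have h1 := qSpec_ub hc hn0
  have h2 := qSpec_Q_lb n k hn
  have h3 : (∑ x, (dL (crossR G) x : ℝ)) + ((∑ x, mL (crossR G) x : ℕ) : ℝ) = n * n := by
    rw [Nat.cast_sum, ← Finset.sum_add_distrib]
    have : ∀ x, (dL (crossR G) x : ℝ) + (mL (crossR G) x : ℝ) = n := fun x => by
      exact_mod_cast dL_add (crossR G) x
    simp [this]
  set e := ∑ x, (dL (crossR G) x : ℝ)
  have h4 : n * (e / n) = e := by field_simp
  constructor
  · have h5 : (n - k - 1 : ℝ) ≤ e / n := by linarith [h2.1]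
    have h6 : n * (n - k - 1 : ℝ) ≤ e := by rw [← h4]; exact mul_le_mul_of_nonneg_left h5 hnr.le
    have : ((∑ x, mL (crossR G) x : ℕ) : ℝ) ≤ n * (k + 1) := by nlinarith
    exact_mod_cast this
  · intro hk
    have h5 : (n - k - 1 : ℝ) < e / n := by linarith [h2.2 hk]
    have h6 : n * (n - k - 1 : ℝ) < e := by rw [← h4]; exact mul_lt_mul_of_pos_left h5 hnr
    have : ((∑ x, mL (crossR G) x : ℕ) : ℝ) < n * (k + 1) := by nlinarith
    exact_mod_cast this

lemma dL_mono {r r' : Fin n → Fin n → Prop} (h : ∀ x y, r x y → r' x y) (x : Fin n) :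
    dL r x ≤ dL r' x :=
  Finset.card_le_card fun y hy =>
    Finset.mem_filter.2 ⟨Finset.mem_univ _, h x y (Finset.mem_filter.1 hy).2⟩

lemma dR_mono {r r' : Fin n → Fin n → Prop} (h : ∀ x y, r x y → r' x y) (x : Fin n) :
    dR r x ≤ dR r' x :=
  Finset.card_le_card fun y hy =>
    Finset.mem_filter.2 ⟨Finset.mem_univ _, h y x (Finset.mem_filter.1 hy).2⟩

lemma R_case {G : SimpleGraph (Fin n ⊕ Fin n)} (hc : CrossOnly G) (hn : 9 ≤ n)
    (x0 y0 : Fin n) (h : ∀ a b, crossR G a b → (a = x0 ↔ b = y0)) : qSpec G ≤ 2 * n - 2 := by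
  have : Nonempty (Fin n ⊕ Fin n) := ⟨Sum.inl x0⟩
  have hnr : (9 : ℝ) ≤ n := by exact_mod_cast hn
  have hL : ∀ x, dL (crossR G) x ≤ n - 1 := by
    intro x
    by_cases hx : x = x0
    · have : dL (crossR G) x ≤ 1 := by
        unfold dL
        rw [Finset.card_le_one]
        intro a ha b hb
        rw [(h x a (Finset.mem_filter.1 ha).2).1 hx, (h x b (Finset.mem_filter.1 hb).2).1 hx]
      omega
    · have : y0 ∉ (Finset.univ.filter fun y => crossR G x y) := by
        intro hm
        exact hx ((h x y0 (Finset.mem_filter.1 hm).2).2 rfl)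
      have := Finset.card_lt_univ_of_notMem this
      simp only [Fintype.card_fin] at this
      unfold dL
      omega
  have hR : ∀ y, dR (crossR G) y ≤ n - 1 := by
    intro x
    by_cases hx : x = y0
    · have : dR (crossR G) x ≤ 1 := by
        unfold dR
        rw [Finset.card_le_one]
        intro a ha b hb
        rw [(h a x (Finset.mem_filter.1 ha).2).2 hx, (h b x (Finset.mem_filter.1 hb).2).2 hx]
      omega
    · have : x0 ∉ (Finset.univ.filter fun y => crossR G y x) := by
        intro hm
        exact hx ((h x0 x (Finset.mem_filter.1 hm).2).1 rfl)
      have := Finset.card_lt_univ_of_notMem this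
      simp only [Fintype.card_fin] at this
      unfold dR
      omega
  have hall : ∀ a, (G.degree a : ℝ) ≤ n - 1 := by
    rintro (x | y)
    · rw [deg_inl hc]
      have := hL x
      have : dL (crossR G) x + 1 ≤ n := by omega
      have : ((dL (crossR G) x : ℝ)) + 1 ≤ n := by exact_mod_cast this
      linarith
    · rw [deg_inr hc]
      have := hR y
      have : dR (crossR G) y + 1 ≤ n := by omega
      have : ((dR (crossR G) y : ℝ)) + 1 ≤ n := by exact_mod_cast this
      linarith
  apply qSpec_le
  · linarith
  · intro a
    calc (∑ b, if G.Adj a b then (G.degree b : ℝ) else 0)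
        ≤ ∑ b, (n - 1 : ℝ) * if G.Adj a b then (1 : ℝ) else 0 := by
          refine Finset.sum_le_sum fun b _ => ?_
          split_ifs
          · simpa using hall b
          · simp
      _ = (n - 1 : ℝ) * G.degree a := by rw [← Finset.mul_sum, deg_sum]
      _ ≤ _ := by
          apply mul_le_mul_of_nonneg_right _ (Nat.cast_nonneg _)
          linarith [hall a]

end Spec

section Extremal

variable {n : ℕ}

/-- The candidate extremal graph attached to a set `Z` on the left and `F` on the right. -/
def Qstar (Z F : Finset (Fin n)) : SimpleGraph (Fin n ⊕ Fin n) :=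
  SimpleGraph.fromRel (fun a b =>
    match a, b with
    | Sum.inl x, Sum.inr y => x ∉ Z ∨ y ∈ F
    | _, _ => False)

lemma Qstar_cross (Z F : Finset (Fin n)) : CrossOnly (Qstar Z F) := by
  constructor <;> intro x y h <;> simp [Qstar] at h

lemma Qstar_adj (Z F : Finset (Fin n)) (x y : Fin n) :
    crossR (Qstar Z F) x y ↔ (x ∉ Z ∨ y ∈ F) := by
  simp [crossR, Qstar]

lemma cross_ext {G H : SimpleGraph (Fin n ⊕ Fin n)} (hG : CrossOnly G) (hH : CrossOnly H)
    (h : ∀ x y, crossR G x y ↔ crossR H x y) : G = H := by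
  ext a b
  rcases a with x | x <;> rcases b with y | y
  · exact iff_of_false (hG.1 x y) (hH.1 x y)
  · exact h x y
  · rw [G.adj_comm, H.adj_comm]; exact h y x
  · exact iff_of_false (hG.2 x y) (hH.2 x y)

lemma Qstar_iso (k : ℕ) (hk : k + 1 ≤ n) (Z F : Finset (Fin n)) (hZ : Z.card = k + 1) (hF : F.card = k) :
    Nonempty (Qstar Z F ≃g Qgraph n k) := by
  obtain ⟨z0, hz0⟩ : Z.Nonempty := Finset.card_pos.1 (by omega)
  obtain ⟨f0, hf0⟩ : Fᶜ.Nonempty := Finset.card_pos.1 (by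
    rw [Finset.card_compl, Fintype.card_fin]; omega)
  obtain ⟨α, hα, -⟩ := enumW Zᶜ (n - k - 1) (by rw [Finset.card_compl, Fintype.card_fin]; omega) z0
    (by simpa using hz0)
  obtain ⟨β, hβ, -⟩ := enumW F k hF f0 (Finset.mem_compl.1 hf0)
  have hα' : ∀ x, (α.symm x).val < n - k - 1 ↔ x ∉ Z := by
    intro x; rw [hα]; simp
  have hβ' : ∀ y, (β.symm y).val < k ↔ y ∈ F := by
    intro x; rw [hβ]; simp
  refine ⟨⟨(Equiv.sumCongr α.symm β.symm).trans (Equiv.sumComm _ _), ?_⟩⟩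
  intro a b
  rcases a with x | x <;> rcases b with y | y
  · exact iff_of_false ((Qgraph_cross n k).2 _ _) ((Qstar_cross Z F).1 _ _)
  · rw [SimpleGraph.adj_comm]
    refine (Qgraph_adj n k (β.symm y) (α.symm x)).trans ?_
    refine Iff.trans ?_ (Qstar_adj Z F x y).symm
    rw [hα', hβ', or_comm]
  · rw [SimpleGraph.adj_comm (Qstar Z F)]
    refine (Qgraph_adj n k (β.symm x) (α.symm y)).trans ?_
    refine Iff.trans ?_ (Qstar_adj Z F y x).symm
    rw [hα', hβ', or_comm]
  · exact iff_of_false ((Qgraph_cross n k).1 _ _) ((Qstar_cross Z F).2 _ _)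

lemma exists_top_set (u : Fin n → ℝ) (k : ℕ) (hk : k ≤ n) :
    ∃ F : Finset (Fin n), F.card = k ∧ ∀ y ∈ F, ∀ y', y' ∉ F → u y' ≤ u y := by
  induction k with
  | zero => exact ⟨∅, rfl, by simp⟩
  | succ k ih =>
    obtain ⟨F, hF, hm⟩ := ih (by omega)
    have hne : Fᶜ.Nonempty := Finset.card_pos.1 (by
      rw [Finset.card_compl, Fintype.card_fin]; omega)
    obtain ⟨w, hw, hwm⟩ := Finset.exists_max_image Fᶜ u hne
    refine ⟨insert w F, ?_, ?_⟩
    · rw [Finset.card_insert_of_notMem (Finset.mem_compl.1 hw), hF]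
    · intro y hy y' hy'
      rw [Finset.mem_insert, not_or] at hy'
      rcases Finset.mem_insert.1 hy with rfl | hy
      · exact hwm y' (Finset.mem_compl.2 hy'.2)
      · exact hm y hy y' hy'.2

lemma sum_top_le (f : Fin n → ℝ) (N F : Finset (Fin n)) (hcard : N.card = F.card)
    (h : ∀ y ∈ F, ∀ y', y' ∉ F → f y' ≤ f y) : ∑ y ∈ N, f y ≤ ∑ y ∈ F, f y := by
  rw [← Finset.sum_inter_add_sum_sdiff N F f, ← Finset.sum_inter_add_sum_sdiff F N f, Finset.inter_comm F N]
  have hc : (N \ F).card = (F \ N).card := Finset.card_sdiff_comm hcard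
  refine add_le_add le_rfl ?_
  rcases (F \ N).eq_empty_or_nonempty with h0 | h0
  · rw [h0, Finset.card_empty, Finset.card_eq_zero] at hc
    rw [h0, hc]
  · obtain ⟨w, hw, hwm⟩ := Finset.exists_min_image (F \ N) f h0
    calc ∑ y ∈ N \ F, f y ≤ (N \ F).card • f w :=
          Finset.sum_le_card_nsmul _ _ _ fun y hy =>
            h w (Finset.mem_sdiff.1 hw).1 y (Finset.mem_sdiff.1 hy).2
      _ = (F \ N).card • f w := by rw [hc]
      _ ≤ _ := Finset.card_nsmul_le_sum _ _ _ hwm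

lemma Qstar_pos (k : ℕ) (Z F : Finset (Fin n)) (hF : F.card = k)
    (u : Fin n ⊕ Fin n → ℝ) (hu : u ≠ 0) (hu0 : ∀ a, 0 ≤ u a) (q : ℝ) (hq : (k : ℝ) < q)
    (he : (signlessLaplacian (Qstar Z F)).mulVec u = q • u) (hZ : ∃ x, x ∉ Z) :
    (∀ x, x ∉ Z → 0 < u (Sum.inl x)) ∧ ∀ y, 0 < u (Sum.inr y) := by
  have eL : ∀ x, (∑ y, if crossR (Qstar Z F) x y then u (Sum.inl x) + u (Sum.inr y) else 0) =
      q * u (Sum.inl x) := by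
    intro x; rw [← mv_inl (Qstar_cross Z F), he]; rfl
  have eR : ∀ y, (∑ x, if crossR (Qstar Z F) x y then u (Sum.inl x) + u (Sum.inr y) else 0) =
      q * u (Sum.inr y) := by
    intro x; rw [← mv_inr (Qstar_cross Z F), he]; rfl
  have nn : ∀ x y, 0 ≤ (if crossR (Qstar Z F) x y then u (Sum.inl x) + u (Sum.inr y) else 0) := by
    intro x y
    split_ifs
    · exact add_nonneg (hu0 _) (hu0 _)
    · exact le_rfl
  have zL : ∀ x, u (Sum.inl x) = 0 → ∀ y, (x ∉ Z ∨ y ∈ F) → u (Sum.inr y) = 0 := by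
    intro x hx y hxy
    have h := eL x
    rw [hx, mul_zero] at h
    have h2 := (Finset.sum_eq_zero_iff_of_nonneg (fun y _ => by
      have := nn x y; rwa [hx] at this)).1 h y (Finset.mem_univ y)
    rw [if_pos ((Qstar_adj Z F x y).2 hxy)] at h2
    linarith
  have zR : ∀ y, u (Sum.inr y) = 0 → ∀ x, (x ∉ Z ∨ y ∈ F) → u (Sum.inl x) = 0 := by
    intro y hy x hxy
    have h := eR y
    rw [hy, mul_zero] at h
    have h2 := (Finset.sum_eq_zero_iff_of_nonneg (fun x _ => by
      have := nn x y; rwa [hy] at this)).1 h x (Finset.mem_univ x)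
    rw [if_pos ((Qstar_adj Z F x y).2 hxy)] at h2
    linarith
  have A : ∀ x, x ∉ Z → u (Sum.inl x) ≠ 0 := by
    intro x hx hx0
    have hy : ∀ y, u (Sum.inr y) = 0 := fun y => zL x hx0 y (Or.inl hx)
    apply hu
    funext a
    rcases a with a | a
    · by_cases ha : a ∈ Z
      · have h := eL a
        have h2 : ∀ y, (if crossR (Qstar Z F) a y then u (Sum.inl a) + u (Sum.inr y) else 0) =
            if y ∈ F then u (Sum.inl a) else 0 := by
          intro y
          have : crossR (Qstar Z F) a y ↔ y ∈ F := by rw [Qstar_adj]; simp [ha]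
          simp only [this, hy, add_zero]
        simp only [h2] at h
        rw [Finset.sum_ite_mem, Finset.univ_inter, Finset.sum_const, nsmul_eq_mul, hF] at h
        have : (q - k) * u (Sum.inl a) = 0 := by linarith
        rcases mul_eq_zero.1 this with h | h
        · linarith
        · exact h
      · exact zR x (hy x) a (Or.inl ha)
    · exact hy a
  refine ⟨fun x hx => lt_of_le_of_ne (hu0 _) (A x hx).symm, fun y => lt_of_le_of_ne (hu0 _) fun h => ?_⟩
  obtain ⟨x, hx⟩ := hZ
  exact A x hx (zR y h.symm x (Or.inl hx))

theorem extremal {G : SimpleGraph (Fin n ⊕ Fin n)} (k : ℕ) (hc : CrossOnly G) (hn : (k + 2) ^ 2 ≤ n)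
    (hq : qSpec (Qgraph n k) ≤ qSpec G) (Z : Finset (Fin n)) (hZ : Z.card = k + 1)
    (hd : ∀ z ∈ Z, dL (crossR G) z = k) : Nonempty (G ≃g Qgraph n k) := by
  have hkn : k + 2 ≤ n := by nlinarith
  have hne : Nonempty (Fin n ⊕ Fin n) := ⟨Sum.inl ⟨0, by omega⟩⟩
  obtain ⟨u, hu, hu0, hGu⟩ := exists_top_nonneg G
  obtain ⟨F, hF, hFt⟩ := exists_top_set (fun y => u (Sum.inr y)) k (by omega)
  obtain ⟨iso⟩ := Qstar_iso k (by omega) Z F hZ hF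
  have hqs : qSpec (Qstar Z F) = qSpec (Qgraph n k) := qSpec_iso iso
  have hsc := Qstar_cross Z F
  obtain ⟨x1, hx1⟩ : ∃ x, x ∉ Z := by
    obtain ⟨x, hx⟩ : Zᶜ.Nonempty := Finset.card_pos.1 (by
      rw [Finset.card_compl, Fintype.card_fin]; omega)
    exact ⟨x, Finset.mem_compl.1 hx⟩
  have hform : dotProduct u ((signlessLaplacian G).mulVec u) ≤
      dotProduct u ((signlessLaplacian (Qstar Z F)).mulVec u) := by
    rw [form_eq hc, form_eq hsc]
    refine Finset.sum_le_sum fun x _ => ?_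
    by_cases hx : x ∈ Z
    · have h2 : ∀ y, crossR (Qstar Z F) x y ↔ y ∈ F := by
        intro y; rw [Qstar_adj]; simp [hx]
      simp only [h2]
      rw [← Finset.sum_filter, Finset.sum_ite_mem, Finset.univ_inter]
      apply sum_top_le
      · rw [hF]; exact hd x hx
      · intro y hy y' hy'
        have h3 := hFt y hy y' hy'
        have h4 := hu0 (Sum.inl x)
        have h5 := hu0 (Sum.inr y')
        gcongr
    · refine Finset.sum_le_sum fun y _ => ?_
      rw [if_pos ((Qstar_adj Z F x y).2 (Or.inl hx))]
      split_ifs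
      · exact le_rfl
      · positivity
  have huu : 0 < dotProduct u u := by
    have h0 : 0 ≤ dotProduct u u := Finset.sum_nonneg fun i _ => mul_self_nonneg _
    exact lt_of_le_of_ne h0 fun h => hu (dotProduct_self_eq_zero.1 h.symm)
  have e1 : dotProduct u ((signlessLaplacian G).mulVec u) = qSpec G * dotProduct u u := by
    rw [hGu, dotProduct_smul, smul_eq_mul]
  have e2 := rayleigh (Qstar Z F) u
  have e3 : qSpec (Qstar Z F) * dotProduct u u ≤ qSpec G * dotProduct u u := by
    rw [hqs]; exact mul_le_mul_of_nonneg_right hq huu.le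
  have hQu := eq_of_rayleigh (Qstar Z F) u (by linarith)
  have hqq : qSpec (Qstar Z F) = qSpec G :=
    mul_right_cancel₀ huu.ne' (by linarith : qSpec (Qstar Z F) * dotProduct u u = qSpec G * dotProduct u u)
  have hqk : (k : ℝ) < qSpec (Qstar Z F) := by
    rw [hqs]
    have := (qSpec_Q_lb n k hn).1
    have h2 : ((k : ℝ) + 2) ≤ n := by exact_mod_cast hkn
    linarith
  obtain ⟨pL, pR⟩ := Qstar_pos k Z F hF u hu hu0 _ hqk hQu ⟨x1, hx1⟩
  have heq : (signlessLaplacian G).mulVec u = (signlessLaplacian (Qstar Z F)).mulVec u := by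
    rw [hGu, hQu, hqq]
  -- rows outside Z are complete
  have hrow : ∀ x, x ∉ Z → ∀ y, crossR G x y := by
    intro x hx y
    have h1 := congrFun heq (Sum.inl x)
    rw [mv_inl hc, mv_inl hsc] at h1
    have h2 := (Finset.sum_eq_sum_iff_of_le (fun y _ => by
      rw [if_pos ((Qstar_adj Z F x y).2 (Or.inl hx))]
      split_ifs
      · exact le_rfl
      · exact add_nonneg (hu0 _) (hu0 _))).1 h1 y (Finset.mem_univ y)
    rw [if_pos ((Qstar_adj Z F x y).2 (Or.inl hx))] at h2
    by_contra h
    rw [if_neg h] at h2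
    linarith [pL x hx, pR y]
  have hcol : ∀ y, y ∉ F → ∀ z ∈ Z, ¬ crossR G z y := by
    intro y hy z hz h
    have h1 := congrFun heq (Sum.inr y)
    rw [mv_inr hc, mv_inr hsc] at h1
    have h2 := (Finset.sum_eq_sum_iff_of_le (fun x _ => by
      by_cases hx : x ∈ Z
      · rw [if_neg (by rw [Qstar_adj]; simp [hx, hy])]
        split_ifs
        · exact add_nonneg (hu0 _) (hu0 _)
        · exact le_rfl
      · rw [if_pos ((Qstar_adj Z F x y).2 (Or.inl hx)), if_pos (hrow x hx y)])).1 h1.symm z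
      (Finset.mem_univ z)
    rw [if_neg (by rw [Qstar_adj]; simp [hz, hy]), if_pos h] at h2
    linarith [hu0 (Sum.inl z), pR y]
  have hfin : G = Qstar Z F := by
    apply cross_ext hc hsc
    intro x y
    rw [Qstar_adj]
    by_cases hx : x ∈ Z
    · have hsub : (Finset.univ.filter fun y => crossR G x y) ⊆ F := by
        intro y hy
        by_contra h
        exact hcol y h x hx (Finset.mem_filter.1 hy).2
      have := Finset.eq_of_subset_of_card_le hsub (by rw [hF]; exact (hd x hx).ge)
      constructor
      · intro h
        exact Or.inr (hsub (Finset.mem_filter.2 ⟨Finset.mem_univ _, h⟩))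
      · rintro (h | h)
        · exact absurd hx h
        · rw [← this] at h
          exact (Finset.mem_filter.1 h).2
    · exact iff_of_true (hrow x hx y) (Or.inl hx)
  rw [hfin]
  exact ⟨iso⟩

end Extremal

section Final

variable {n : ℕ}

lemma core {G H : SimpleGraph (Fin n ⊕ Fin n)} (k : ℕ) (hGH : G ≤ H) (hcG : CrossOnly G)
    (hcH : CrossOnly H) (hT : ¬ TrL H)
    (hs : ∀ x y, ¬ H.Adj (Sum.inl x) (Sum.inr y) → H.degree (Sum.inl x) + H.degree (Sum.inr y) ≤ n)
    (hn : (k + 2) ^ 2 ≤ n) (hdeg : ∀ v, k ≤ G.degree v) (hq : qSpec (Qgraph n k) ≤ qSpec G)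
    (x y : Fin n) (hxy : ¬ H.Adj (Sum.inl x) (Sum.inr y))
    (hle : H.degree (Sum.inl x) ≤ H.degree (Sum.inr y))
    (hmax : ∀ x' y', ¬ H.Adj (Sum.inl x') (Sum.inr y') →
      H.degree (Sum.inl x') + H.degree (Sum.inr y') ≤ H.degree (Sum.inl x) + H.degree (Sum.inr y)) :
    Nonempty (G ≃g Qgraph n k) := by
  simp only [deg_inl hcH, deg_inr hcH] at hs hle hmax
  have hmono : ∀ a b, crossR G a b → crossR H a b := fun a b h => hGH h
  have hdG : ∀ a, k ≤ dL (crossR G) a := fun a => by rw [← deg_inl hcG]; exact hdeg _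
  have hdL : ∀ a, k ≤ dL (crossR H) a := fun a => (hdG a).trans (dL_mono hmono a)
  have hdR : ∀ a, k ≤ dR (crossR H) a := fun a => by
    refine le_trans ?_ (dR_mono hmono a)
    rw [← deg_inr hcG]; exact hdeg _
  have hMm : ∑ x, mL (crossR H) x ≤ ∑ x, mL (crossR G) x := by
    refine Finset.sum_le_sum fun a _ => ?_
    have h1 := dL_add (crossR H) a
    have h2 := dL_add (crossR G) a
    have h3 := dL_mono hmono a
    omega
  obtain ⟨hM, hM'⟩ := missing_bound k hcG hn hq
  rcases structS (crossR H) k hn hdL hdR hs (hMm.trans hM) (fun h => hMm.trans_lt (hM' h))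
    (fun ⟨f, g, h1, h2⟩ => hT (trL_of_enum f g h1 h2)) x y hxy hle hmax with ⟨Z, hZ, hZd⟩ | ⟨hk, x0, y0, hr⟩
  · refine extremal k hcG hn hq Z hZ fun z hz => le_antisymm ?_ (hdG z)
    rw [← hZd z hz]
    exact dL_mono hmono z
  · exfalso
    subst hk
    have h1 := R_case hcG (by omega) x0 y0 (fun a b h => hr a b (hmono a b h))
    have h2 := (qSpec_Q_lb n 1 hn).2 le_rfl
    push_cast at h2
    linarith

/-- The graph with the two parts exchanged. -/
def swapG (G : SimpleGraph (Fin n ⊕ Fin n)) : SimpleGraph (Fin n ⊕ Fin n) :=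
  G.comap (Equiv.sumComm (Fin n) (Fin n))

/-- Exchanging the parts is an isomorphism. -/
def swapIso (G : SimpleGraph (Fin n ⊕ Fin n)) : swapG G ≃g G :=
  SimpleGraph.Iso.comap (Equiv.sumComm (Fin n) (Fin n)) G

lemma swap_cross {G : SimpleGraph (Fin n ⊕ Fin n)} (h : CrossOnly G) :
    CrossOnly (swapG G) :=
  ⟨fun x y => h.2 x y, fun x y => h.1 x y⟩

lemma swap_deg (G : SimpleGraph (Fin n ⊕ Fin n)) (v : Fin n ⊕ Fin n) :
    (swapG G).degree v = G.degree v.swap :=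
  ((swapIso G).degree_eq v).symm

lemma swap_deg_inl (G : SimpleGraph (Fin n ⊕ Fin n)) (x : Fin n) :
    (swapG G).degree (Sum.inl x) = G.degree (Sum.inr x) := swap_deg G (Sum.inl x)

lemma swap_deg_inr (G : SimpleGraph (Fin n ⊕ Fin n)) (x : Fin n) :
    (swapG G).degree (Sum.inr x) = G.degree (Sum.inl x) := swap_deg G (Sum.inr x)

lemma exists_closure {G : SimpleGraph (Fin n ⊕ Fin n)} (hc : CrossOnly G) (hT : ¬ TrL G) :
    ∃ H, G ≤ H ∧ CrossOnly H ∧ ¬ TrL H ∧ ∀ x y, ¬ H.Adj (Sum.inl x) (Sum.inr y) →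
      H.degree (Sum.inl x) + H.degree (Sum.inr y) ≤ n := by
  obtain ⟨H, hGH, hH⟩ := Finite.exists_le_maximal (p := fun H : SimpleGraph (Fin n ⊕ Fin n) =>
    CrossOnly H ∧ ¬ TrL H) (a := G) ⟨hc, hT⟩
  refine ⟨H, hGH, hH.prop.1, hH.prop.2, fun x y hxy => ?_⟩
  set H' := H ⊔ SimpleGraph.edge (Sum.inl x) (Sum.inr y) with hH'
  have hadj : ∀ a b, H'.Adj a b → H.Adj a b ∨ (a = Sum.inl x ∧ b = Sum.inr y) ∨
      (a = Sum.inr y ∧ b = Sum.inl x) := by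
    intro a b hab
    rw [hH', SimpleGraph.sup_adj, SimpleGraph.edge_adj] at hab
    tauto
  have hc' : CrossOnly H' := by
    constructor
    · intro a b hab
      rcases hadj _ _ hab with h | h | h
      · exact hH.prop.1.1 _ _ h
      · simp at h
      · simp at h
    · intro a b hab
      rcases hadj _ _ hab with h | h | h
      · exact hH.prop.1.2 _ _ h
      · simp at h
      · simp at h
  have hT' : TrL H' := by
    by_contra h
    have h2 := hH.le_of_ge ⟨hc', h⟩ le_sup_left
    apply hxy
    apply h2
    rw [hH', SimpleGraph.sup_adj, SimpleGraph.edge_adj]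
    simp
  exact closure_lem hH.prop.1 hadj hH.prop.2 hT'

end Final

/-- A balanced bipartite graph on `2n` vertices with `δ(G) ≥ k ≥ 0`, `n ≥ (k+2)²` and
`q(G) ≥ q(Q_n^k)` is traceable unless `G = Q_n^k`. -/
theorem stmt_16 (n k : ℕ) (G : SimpleGraph (Fin n ⊕ Fin n)) (hbip : CrossOnly G)
    (hn : (k + 2) ^ 2 ≤ n) (hdeg : ∀ v, k ≤ G.degree v)
    (hq : qSpec (Qgraph n k) ≤ qSpec G) :
    G.IsTraceable ∨ Nonempty (G ≃g Qgraph n k) := by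
  by_contra hcon
  push Not at hcon
  obtain ⟨hntr, hiso⟩ := hcon
  have hn0 : 0 < n := lt_of_lt_of_le (by positivity) hn
  have hne : Nonempty (Fin n ⊕ Fin n) := ⟨Sum.inl ⟨0, hn0⟩⟩
  have hT : ¬ TrL G := fun h => hntr (isTraceable_of_trL h)
  obtain ⟨H, hGH, hcH, hTH, hs⟩ := exists_closure hbip hT
  have hex : ∃ p : Fin n × Fin n, ¬ H.Adj (Sum.inl p.1) (Sum.inr p.2) := by
    by_contra h
    push Not at h
    exact hTH (trL_of_enum (Equiv.refl _) (Equiv.refl _) (fun i => h (i, i)) (fun i j _ => h (j, i)))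
  obtain ⟨p0, hp0⟩ := hex
  obtain ⟨⟨x, y⟩, hp, hpm⟩ := Finset.exists_max_image
    (Finset.univ.filter fun p : Fin n × Fin n => ¬ H.Adj (Sum.inl p.1) (Sum.inr p.2))
    (fun p => H.degree (Sum.inl p.1) + H.degree (Sum.inr p.2))
    ⟨p0, Finset.mem_filter.2 ⟨Finset.mem_univ _, hp0⟩⟩
  have hxy : ¬ H.Adj (Sum.inl x) (Sum.inr y) := (Finset.mem_filter.1 hp).2
  have hmax : ∀ x' y', ¬ H.Adj (Sum.inl x') (Sum.inr y') →
      H.degree (Sum.inl x') + H.degree (Sum.inr y') ≤ H.degree (Sum.inl x) + H.degree (Sum.inr y) :=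
    fun x' y' h => hpm (x', y') (Finset.mem_filter.2 ⟨Finset.mem_univ _, h⟩)
  have hiso' : ¬ Nonempty (G ≃g Qgraph n k) := fun ⟨e⟩ => hiso.elim e
  apply hiso'
  rcases le_total (H.degree (Sum.inl x)) (H.degree (Sum.inr y)) with hle | hle
  · exact core k hGH hbip hcH hTH hs hn hdeg hq x y hxy hle hmax
  · have isoG := swapIso G
    have isoH := swapIso H
    have hsw : ∀ a b : Fin n, (swapG H).Adj (Sum.inl a) (Sum.inr b) ↔
        H.Adj (Sum.inl b) (Sum.inr a) := fun a b => H.adj_comm _ _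
    obtain ⟨e⟩ := core (G := swapG G)
      (H := swapG H) k (fun a b h => hGH h)
      (swap_cross hbip) (swap_cross hcH) (fun h => hTH (trL_iso isoH h))
      (fun a b h => by
        rw [hsw] at h
        have := hs b a h
        rw [swap_deg_inl, swap_deg_inr]
        omega) hn (fun v => by rw [swap_deg]; exact hdeg _)
      (by rw [qSpec_iso isoG]; exact hq) y x (by rw [hsw]; exact hxy)
      (by rw [swap_deg_inl, swap_deg_inr]; exact hle)
      (fun a b h => by
        rw [hsw] at h
        have := hmax b a h
        rw [swap_deg_inl, swap_deg_inr, swap_deg_inl, swap_deg_inr]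
        omega)
    exact ⟨isoG.symm.trans e⟩
end

section
/- Let G be a balanced bipartite graph on 2n vertices with δ(G) ≥ k, where k ≥ 1 and n ≥ 2k. If ρ(Ĝ) ≤ ρ(R̂_n^k) = √(k(n−k)), then G is traceable unless G = R_n^k. -/
open SimpleGraph

attribute [local instance] Classical.propDecidable

section core
variable {V W : Type*}

inductive HP (K : SimpleGraph V) : Set V → V → V → Prop
  | single (u : V) : HP K {u} u u
  | cons {S : Set V} {u v w : V} (h : K.Adj u v) (hp : HP K S v w) (hu : u ∉ S) :
      HP K (insert u S) u w

theorem HP.congr {K : SimpleGraph V} {S T : Set V} {u v : V} (h : HP K S u v) (e : S = T) :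
    HP K T u v := e ▸ h

theorem HP.join {K : SimpleGraph V} {S T : Set V} {u v w z : V} (h : HP K S u v)
    (h' : HP K T w z) (a : K.Adj v w) (d : Disjoint S T) : HP K (S ∪ T) u z := by
  induction h with
  | single u =>
    exact (HP.cons a h' (by simpa using d)).congr (Set.insert_eq _ _)
  | cons h hp hu ih =>
    rw [Set.disjoint_insert_left] at d
    refine (HP.cons h (ih a d.2) ?_).congr (by rw [Set.insert_union])
    simp [hu, d.1]

theorem HP.symm {K : SimpleGraph V} {S : Set V} {u v : V} (h : HP K S u v) : HP K S v u := by
  induction h with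
  | single u => exact .single u
  | cons h hp hu ih =>
    refine (ih.join (.single _) h.symm (by simpa using hu)).congr ?_
    ext x; simp

theorem HP.map {K : SimpleGraph W} {f : V → W} {S : Set V} {u v : V}
    (h : HP (K.comap f) S u v) (hf : Set.InjOn f S) : HP K (f '' S) (f u) (f v) := by
  induction h with
  | single u => simpa using HP.single (K := K) (f u)
  | @cons S u v w h hp hu ih =>
    rw [Set.image_insert_eq]
    refine HP.cons h (ih (hf.mono (Set.subset_insert _ _))) ?_
    rintro ⟨y, hy, e⟩
    exact hu ((hf (Set.mem_insert_of_mem _ hy) (Set.mem_insert _ _) e) ▸ hy)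

theorem HP.toWalk {K : SimpleGraph V} {S : Set V} {u v : V} (h : HP K S u v) :
    ∃ p : K.Walk u v, p.IsPath ∧ ∀ x, x ∈ p.support ↔ x ∈ S := by
  induction h with
  | single u => exact ⟨.nil, by simp, by simp⟩
  | cons h hp hu ih =>
    obtain ⟨p, h1, h2⟩ := ih
    refine ⟨.cons h p, ?_, ?_⟩
    · rw [SimpleGraph.Walk.cons_isPath_iff]
      exact ⟨h1, by rwa [h2]⟩
    · intro x; simp [h2]

theorem HP.traceable {K : SimpleGraph V} {u v : V} (h : HP K Set.univ u v) : K.IsTraceable := by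
  obtain ⟨p, h1, h2⟩ := h.toWalk
  refine ⟨u, v, p, ?_⟩
  intro x
  exact List.count_eq_one_of_mem h1.support_nodup ((h2 x).2 trivial)

theorem HP.up {K : SimpleGraph ℕ} {a b : ℕ} (hab : a ≤ b)
    (h : ∀ i, a ≤ i → i < b → K.Adj i (i+1)) : HP K (Set.Icc a b) a b := by
  induction b, hab using Nat.le_induction with
  | base => simpa using HP.single a
  | succ b hb ih =>
    refine ((ih fun i h1 h2 => h i h1 (by omega)).join (.single (b+1)) (h b hb (by omega))
      (by simp)).congr ?_
    ext x; simp; omega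

theorem HP.down {K : SimpleGraph ℕ} {a b : ℕ} (hab : a ≤ b)
    (h : ∀ i, a ≤ i → i < b → K.Adj i (i+1)) : HP K (Set.Icc a b) b a := (HP.up hab h).symm

/-- degree inside `0..2n-1` -/
noncomputable def dg (K : SimpleGraph ℕ) (n i : ℕ) : ℕ := ((Finset.range (2*n)).filter (K.Adj i)).card

structure Cfg (K : SimpleGraph ℕ) (n r : ℕ) : Prop where
  hr : r + 1 < 2 * n
  par : ∀ i < 2*n, ∀ j < 2*n, K.Adj i j → i % 2 ≠ j % 2
  path : ∀ i, i + 1 < 2*n → i ≠ r → K.Adj i (i+1)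
  nt : ∀ u v, ¬ HP K (Set.Iio (2*n)) u v

theorem Cfg.dg_even {K : SimpleGraph ℕ} {n r : ℕ} (c : Cfg K n r) {u : ℕ} (hu : u < 2*n)
    (he : u % 2 = 0) : dg K n u = ((Finset.range n).filter (fun t => K.Adj u (2*t+1))).card := by
  symm
  apply Finset.card_bij (fun t _ => 2*t+1)
  · intro t ht
    simp only [Finset.mem_filter, Finset.mem_range] at ht ⊢
    exact ⟨by omega, ht.2⟩
  · intros; omega
  · intro j hj
    simp at hj
    have := c.par u hu j hj.1 hj.2
    refine ⟨j/2, ?_, by omega⟩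
    have e : 2*(j/2)+1 = j := by omega
    simp [e, hj.2]; omega

theorem Cfg.dg_odd {K : SimpleGraph ℕ} {n r : ℕ} (c : Cfg K n r) {u : ℕ} (hu : u < 2*n)
    (he : u % 2 = 1) : dg K n u = ((Finset.range n).filter (fun t => K.Adj u (2*t))).card := by
  symm
  apply Finset.card_bij (fun t _ => 2*t)
  · intro t; simp
  · intros; omega
  · intro j hj
    simp at hj
    have := c.par u hu j hj.1 hj.2
    refine ⟨j/2, ?_, by omega⟩
    have e : 2*(j/2) = j := by omega
    simp [e, hj.2]; omega

theorem Cfg.x1 {K : SimpleGraph ℕ} {n r : ℕ} (c : Cfg K n r) {t : ℕ} (h : t + 1 < 2*n)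
    (hne : t ≠ r) (h1 : K.Adj r t) (h2 : K.Adj (r+1) (t+1)) : False := by
  have hr := c.hr
  rcases lt_or_gt_of_ne hne with hlt | hgt
  · have a := HP.up (K := K) (a := 0) (b := t) (by omega) (fun i _ _ => c.path i (by omega) (by omega))
    have b := HP.down (K := K) (a := t+1) (b := r) (by omega) (fun i _ _ => c.path i (by omega) (by omega))
    have d := HP.up (K := K) (a := r+1) (b := 2*n-1) (by omega) (fun i _ _ => c.path i (by omega) (by omega))
    refine c.nt _ _ (((a.join b h1.symm ?_).join d h2.symm ?_).congr ?_)
    · rw [Set.disjoint_left]; intro x; simp; omega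
    · rw [Set.disjoint_left]; intro x; simp; omega
    · ext x; simp; omega
  · have a := HP.up (K := K) (a := 0) (b := r) (by omega) (fun i _ _ => c.path i (by omega) (by omega))
    have b := HP.down (K := K) (a := r+1) (b := t) (by omega) (fun i _ _ => c.path i (by omega) (by omega))
    have d := HP.up (K := K) (a := t+1) (b := 2*n-1) (by omega) (fun i _ _ => c.path i (by omega) (by omega))
    refine c.nt _ _ (((a.join b h1 ?_).join d h2 ?_).congr ?_)
    · rw [Set.disjoint_left]; intro x; simp; omega
    · rw [Set.disjoint_left]; intro x; simp; omega
    · ext x; simp; omega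

theorem Cfg.P1 {K : SimpleGraph ℕ} {n r : ℕ} (c : Cfg K n r) : HP K (Set.Icc 0 r) 0 r :=
  have hr := c.hr
  HP.up (by omega) (fun i _ _ => c.path i (by omega) (by omega))

theorem Cfg.P2 {K : SimpleGraph ℕ} {n r : ℕ} (c : Cfg K n r) :
    HP K (Set.Icc (r+1) (2*n-1)) (r+1) (2*n-1) :=
  have hr := c.hr
  HP.up (by omega) (fun i _ _ => c.path i (by omega) (by omega))

theorem Cfg.nojoin {K : SimpleGraph ℕ} {n r : ℕ} (c : Cfg K n r) {u v w z : ℕ}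
    (h1 : HP K (Set.Icc 0 r) u v) (h2 : HP K (Set.Icc (r+1) (2*n-1)) w z) : ¬ K.Adj v w := by
  intro h
  have hr := c.hr
  refine c.nt _ _ ((h1.join h2 h ?_).congr ?_)
  · rw [Set.disjoint_left]; intro x; simp; omega
  · ext x; simp; omega

theorem card_disj {n : ℕ} (p q : ℕ → Prop) (h : ∀ t < n, p t → q t → False) :
    ((Finset.range n).filter p).card + ((Finset.range n).filter q).card ≤ n := by
  rw [← Finset.card_union_of_disjoint]
  · calc _ ≤ (Finset.range n).card := Finset.card_le_card (by intro x; simp; tauto)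
      _ = n := by simp
  · rw [Finset.disjoint_left]; intro x; simp; intro a b _ d; exact h x a b d

theorem card_cover {n : ℕ} (p q : ℕ → Prop) (h : ∀ t < n, p t → q t → False)
    (e : ((Finset.range n).filter p).card + ((Finset.range n).filter q).card = n) :
    ∀ t < n, p t ∨ q t := by
  rw [← Finset.card_union_of_disjoint] at e
  · have := Finset.eq_of_subset_of_card_le (s := (Finset.range n).filter p ∪ (Finset.range n).filter q)
      (t := Finset.range n) (by intro x; simp; tauto) (by simp [e])
    intro t ht
    have h2 : t ∈ Finset.range n := by simpa
    rw [← this] at h2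
    simp at h2; tauto
  · rw [Finset.disjoint_left]; intro x; simp; intro a b _ d; exact h x a b d

theorem Cfg.closure_odd {K : SimpleGraph ℕ} {n r : ℕ} (c : Cfg K n r) (ho : r % 2 = 1) :
    dg K n r + dg K n (r+1) ≤ n := by
  have hr := c.hr
  rw [c.dg_odd (by omega) ho, c.dg_even hr (by omega)]
  exact card_disj _ _ fun t ht h1 h2 => c.x1 (t := 2*t) (by omega) (by omega) h1 h2

theorem Cfg.closure_even {K : SimpleGraph ℕ} {n r : ℕ} (c : Cfg K n r) (ho : r % 2 = 0) :
    dg K n r + dg K n (r+1) < n := by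
  have hr := c.hr
  rw [c.dg_even (by omega) ho, c.dg_odd hr (by omega)]
  have e1 : ¬ K.Adj r (2*n-1) := c.nojoin c.P1 c.P2.symm
  have e2 : ¬ K.Adj 0 (r+1) := c.nojoin c.P1.symm c.P2
  have h0 : (((Finset.range n).filter (fun t => K.Adj r (2*t+1))).image Nat.succ).card
    = ((Finset.range n).filter (fun t => K.Adj r (2*t+1))).card :=
    Finset.card_image_of_injective _ Nat.succ_injective
  rw [← h0, ← Finset.card_union_of_disjoint]
  · calc _ ≤ (Finset.Ico 1 n).card := Finset.card_le_card ?_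
      _ < n := by simp; omega
    intro x
    simp only [Finset.mem_union, Finset.mem_image, Finset.mem_filter, Finset.mem_range, Finset.mem_Ico]
    rintro (⟨t, ⟨h1, h2⟩, rfl⟩ | ⟨h1, h2⟩)
    · refine ⟨by omega, ?_⟩
      by_contra h3
      apply e1
      have : 2*t+1 = 2*n-1 := by omega
      rwa [← this]
    · refine ⟨?_, h1⟩
      by_contra h3
      apply e2
      have : x = 0 := by omega
      subst this
      simpa using h2.symm
  · rw [Finset.disjoint_left]; intro x
    simp only [Finset.mem_image, Finset.mem_filter, Finset.mem_range, not_and]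
    rintro ⟨t, ⟨h1, h2⟩, rfl⟩ h3 h4
    exact c.x1 (t := 2*t+1) (by omega) (by omega) h2 h4

theorem Cfg.flex1 {K : SimpleGraph ℕ} {n r : ℕ} (c : Cfg K n r) (ho : r % 2 = 1)
    (hsum : ∀ i < 2*n, ∀ j < 2*n, i % 2 ≠ j % 2 → ¬ K.Adj i j → dg K n i + dg K n j = n) :
    ∀ v ≤ r, ∃ w, HP K (Set.Icc 0 r) w v := by
  have hr := c.hr
  have pth : ∀ a b, a ≤ b → b ≤ r → HP K (Set.Icc a b) a b := fun a b h1 h2 =>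
    HP.up h1 (fun i _ _ => c.path i (by omega) (by omega))
  intro v hv
  by_cases h0 : K.Adj 0 r
  · rcases Nat.eq_zero_or_pos v with rfl | hv0
    · exact ⟨_, c.P1.symm⟩
    · refine ⟨_, (((pth 0 (v-1) (by omega) (by omega)).symm.join (pth v r hv le_rfl).symm h0 ?_).congr ?_)⟩
      · rw [Set.disjoint_left]; intro x; simp; omega
      · ext x; simp; omega
  by_cases h1 : ∃ t, t + 1 < r ∧ t % 2 = 0 ∧ K.Adj r t ∧ K.Adj 0 (t+1)
  · obtain ⟨t, ht, _, a1, a2⟩ := h1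
    by_cases hvt : v ≤ t
    · -- v..t, r..t+1, 0..v-1
      have q := (pth v t hvt (by omega)).join (pth (t+1) r (by omega) le_rfl).symm a1.symm
        (by rw [Set.disjoint_left]; intro x; simp; omega)
      rcases Nat.eq_zero_or_pos v with rfl | hv0
      · refine ⟨_, q.symm.congr ?_⟩
        ext x; simp; omega
      · refine ⟨_, (q.join (pth 0 (v-1) (by omega) (by omega)) a2.symm ?_).symm.congr ?_⟩
        · rw [Set.disjoint_left]; intro x; simp; omega
        · ext x; simp; omega
    · -- v..r, t..0, t+1..v-1
      have q := (pth v r hv le_rfl).join (pth 0 t (by omega) (by omega)).symm a1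
        (by rw [Set.disjoint_left]; intro x; simp; omega)
      by_cases hv1 : v = t+1
      · refine ⟨_, q.symm.congr ?_⟩
        ext x; simp; omega
      · refine ⟨_, (q.join (pth (t+1) (v-1) (by omega) (by omega)) a2 ?_).symm.congr ?_⟩
        · rw [Set.disjoint_left]; intro x; simp; omega
        · ext x; simp; omega
  exfalso
  have hd := hsum 0 (by omega) r (by omega) (by omega) h0
  rw [c.dg_odd (u := r) (by omega) ho, c.dg_even (u := 0) (by omega) (by omega)] at hd
  have seg2 : ∀ a b, r+1 ≤ a → a ≤ b → b < 2*n → HP K (Set.Icc a b) a b := fun a b h1 h2 h3 =>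
    HP.up h2 (fun i _ _ => c.path i (by omega) (by omega))
  have e0 : ¬ K.Adj 0 (2*n-1) := c.nojoin c.P1.symm c.P2.symm
  have e1 : ¬ K.Adj r (r+1) := c.nojoin c.P1 c.P2
  have key : ∀ t < n, K.Adj 0 (2*t+1) ∨ K.Adj r (2*t) := by
    apply card_cover _ _ _ hd
    intro t ht b1 b2
    by_cases htr : 2*t+1 < r
    · exact h1 ⟨2*t, htr, by omega, b2, b1⟩
    by_cases htr : 2*t+1 = r
    · rw [htr] at b1; exact h0 b1
    refine c.nt _ _ ((((seg2 (r+1) (2*t) le_rfl (by omega) (by omega)).join c.P1.symm b2.symm ?_).join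
      (seg2 (2*t+1) (2*n-1) (by omega) (by omega) (by omega)) b1 ?_).congr ?_)
    · rw [Set.disjoint_left]; intro x; simp; omega
    · rw [Set.disjoint_left]; intro x; simp; omega
    · ext x; simp; omega
  have step : ∀ s, r+1 ≤ s → s + 1 < 2*n → K.Adj 0 s → K.Adj r (s+1) → False := by
    intro s h1 h2 b1 b2
    refine c.nt _ _ ((((seg2 (r+1) s le_rfl (by omega) (by omega)).join c.P1 b1.symm ?_).join
      (seg2 (s+1) (2*n-1) (by omega) (by omega) (by omega)) b2 ?_).congr ?_)
    · rw [Set.disjoint_left]; intro x; simp; omega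
    · rw [Set.disjoint_left]; intro x; simp; omega
    · ext x; simp; omega
  have all : ∀ t, (r+1)/2 ≤ t → t < n → K.Adj 0 (2*t+1) := by
    intro t ht
    induction t, ht using Nat.le_induction with
    | base =>
      intro h
      rcases key _ h with h | h
      · exact h
      · rw [show 2*((r+1)/2) = r+1 by omega] at h
        exact absurd h e1
    | succ t ht ih =>
      intro h
      rcases key _ h with h' | h'
      · exact h'
      · exact (step (2*t+1) (by omega) (by omega) (ih (by omega)) h').elim
  have := all (n-1) (by omega) (by omega)
  rw [show 2*(n-1)+1 = 2*n-1 by omega] at this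
  exact e0 this

def rv (n i : ℕ) : ℕ := 2*n-1-i

theorem rv_inj (n : ℕ) : Set.InjOn (rv n) (Set.Iio (2*n)) := by
  intro a ha b hb h; simp [rv] at *; omega

theorem Cfg.rev {K : SimpleGraph ℕ} {n r : ℕ} (c : Cfg K n r) :
    Cfg (K.comap (rv n)) n (2*n-2-r) := by
  have hr := c.hr
  refine ⟨by omega, ?_, ?_, ?_⟩
  · intro i hi j hj h
    have := c.par _ (by simp [rv]; omega) _ (by simp [rv]; omega) h
    simp only [rv] at this; omega
  · intro i hi hne
    have := c.path (rv n (i+1)) (by simp [rv]; omega) (by simp [rv]; omega)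
    rw [show rv n (i+1) + 1 = rv n i by simp [rv]; omega] at this
    exact this.symm
  · intro u v h
    refine c.nt _ _ ((h.map (rv_inj n)).congr ?_)
    ext x; simp only [Set.mem_image, Set.mem_Iio]
    constructor
    · rintro ⟨y, hy, rfl⟩; simp [rv]; omega
    · intro hx; exact ⟨rv n x, by simp [rv]; omega, by simp [rv]; omega⟩

theorem rv_rv {n i : ℕ} (h : i < 2*n) : rv n (rv n i) = i := by simp [rv]; omega

theorem dg_rev (K : SimpleGraph ℕ) (n i : ℕ) : dg (K.comap (rv n)) n i = dg K n (rv n i) := by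
  apply Finset.card_bij (fun t _ => rv n t)
  · intro t ht
    simp only [Finset.mem_filter, Finset.mem_range] at ht ⊢
    exact ⟨by simp only [rv]; omega, ht.2⟩
  · intro a ha b hb h
    simp [rv] at *; omega
  · intro j hj
    simp at hj
    refine ⟨rv n j, ?_, rv_rv hj.1⟩
    simp [rv_rv hj.1, hj.2]; simp [rv]; omega

/-- everything: the two halves are complete bipartite with no edges in between -/
theorem Cfg.final {K : SimpleGraph ℕ} {n r : ℕ} (c : Cfg K n r) (ho : r % 2 = 1)
    (hsum : ∀ i < 2*n, ∀ j < 2*n, i % 2 ≠ j % 2 → ¬ K.Adj i j → dg K n i + dg K n j = n) :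
    ∀ i ≤ r, ∀ j, r < j → j < 2*n → ¬ K.Adj i j := by
  have hr := c.hr
  intro i hi j hj hj2 hadj
  obtain ⟨w, h1⟩ := c.flex1 ho hsum i hi
  obtain ⟨z, h2⟩ := c.rev.flex1 (by omega) (by
    intro a ha b hb hab hn
    rw [dg_rev, dg_rev]
    exact hsum _ (by simp [rv]; omega) _ (by simp [rv]; omega) (by simp [rv]; omega) hn) (rv n j)
      (by simp [rv]; omega)
  have h3 := h2.map ((rv_inj n).mono (by intro x; simp; omega))
  rw [rv_rv hj2] at h3
  refine c.nojoin h1 (h3.symm.congr ?_) hadj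
  ext x; simp only [Set.mem_image, Set.mem_Icc]
  constructor
  · rintro ⟨y, hy, rfl⟩; simp [rv]; omega
  · intro hx; exact ⟨rv n x, by simp [rv]; omega, by simp [rv]; omega⟩

theorem Cfg.complete {K : SimpleGraph ℕ} {n r : ℕ} (c : Cfg K n r) (ho : r % 2 = 1)
    (hsum : ∀ i < 2*n, ∀ j < 2*n, i % 2 ≠ j % 2 → ¬ K.Adj i j → dg K n i + dg K n j = n) :
    dg K n 0 = (r+1)/2 ∧ ∀ i < 2*n, ∀ j < 2*n, K.Adj i j ↔ (i % 2 ≠ j % 2 ∧ (i ≤ r ↔ j ≤ r)) := by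
  have hr := c.hr
  have hf := c.final ho hsum
  have cardev : ∀ a b : ℕ, ∀ p < 2, ((Finset.Ico (2*a) (2*b)).filter (fun j => p ≠ j % 2)).card = b - a := by
    intro a b p hp
    rw [← Nat.card_Ico a b]
    symm
    apply Finset.card_bij (fun t _ => 2*t+(1-p))
    · intro t; simp; omega
    · intros; omega
    · intro j hj; simp at hj
      exact ⟨j/2, by simp; omega, by omega⟩
  have sub1 : ∀ i ≤ r, (Finset.range (2*n)).filter (K.Adj i) ⊆
      (Finset.Ico (2*0) (2*((r+1)/2))).filter (fun j => i%2 ≠ j % 2) := by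
    intro i hi j
    simp only [Finset.mem_filter, Finset.mem_range, Finset.mem_Ico]
    rintro ⟨h1, h2⟩
    have := c.par i (by omega) j h1 h2
    have : ¬ r < j := fun h => hf i hi j h h1 h2
    omega
  have sub2 : ∀ i, r < i → i < 2*n → (Finset.range (2*n)).filter (K.Adj i) ⊆
      (Finset.Ico (2*((r+1)/2)) (2*n)).filter (fun j => i%2 ≠ j % 2) := by
    intro i hi hi2 j
    simp only [Finset.mem_filter, Finset.mem_range, Finset.mem_Ico]
    rintro ⟨h1, h2⟩
    have := c.par i (by omega) j h1 h2
    have : ¬ j ≤ r := fun h => hf j h i hi hi2 h2.symm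
    omega
  have le1 : ∀ i ≤ r, dg K n i ≤ (r+1)/2 := fun i hi => by
    have := Finset.card_le_card (sub1 i hi)
    rw [cardev _ _ _ (by omega)] at this
    simpa [dg] using this
  have le2 : ∀ i, r < i → i < 2*n → dg K n i ≤ n - (r+1)/2 := fun i hi hi2 => by
    have := Finset.card_le_card (sub2 i hi hi2)
    rw [cardev _ _ _ (by omega)] at this
    simpa [dg] using this
  have ex : ∀ i ≤ r, ∀ j, r < j → j < 2*n → i%2 ≠ j%2 → dg K n i = (r+1)/2 ∧ dg K n j = n - (r+1)/2 := by
    intro i hi j hj hj2 hp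
    have := hsum i (by omega) j hj2 hp (hf i hi j hj hj2)
    have := le1 i hi
    have := le2 j hj hj2
    omega
  have ex1 : ∀ i ≤ r, dg K n i = (r+1)/2 := by
    intro i hi
    by_cases h : i % 2 = 0
    · exact (ex i hi (r+2) (by omega) (by omega) (by omega)).1
    · exact (ex i hi (r+1) (by omega) (by omega) (by omega)).1
  have ex2 : ∀ i, r < i → i < 2*n → dg K n i = n - (r+1)/2 := by
    intro i hi hi2
    by_cases h : i % 2 = 0
    · exact (ex 1 (by omega) i (by omega) (by omega) (by omega)).2
    · exact (ex 0 (by omega) i (by omega) (by omega) (by omega)).2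
  refine ⟨ex1 0 (by omega), ?_⟩
  intro i hi j hj
  by_cases hir : i ≤ r
  · have := Finset.eq_of_subset_of_card_le (sub1 i hir)
      (by rw [cardev _ _ _ (by omega)]; exact (ex1 i hir).ge)
    have h2 := Finset.ext_iff.1 this j
    simp only [Finset.mem_filter, Finset.mem_range, Finset.mem_Ico, hj, true_and, and_true] at h2
    rw [h2]; omega
  · have := Finset.eq_of_subset_of_card_le (sub2 i (by omega) hi)
      (by rw [cardev _ _ _ (by omega)]; exact (ex2 i (by omega) hi).ge)
    have h2 := Finset.ext_iff.1 this j
    simp only [Finset.mem_filter, Finset.mem_range, Finset.mem_Ico, hj, true_and, and_true] at h2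
    rw [h2]
    have : (i ≤ r ↔ j ≤ r) ↔ r < j := by simp only [hir, false_iff]; omega
    rw [this]; omega

end core

section spec
variable {V : Type*} [Fintype V] [DecidableEq V]

theorem specRad_bdd (H : SimpleGraph V) : BddAbove (spectrum ℝ (H.adjMatrix ℝ)) :=
  (Matrix.finite_real_spectrum (A := H.adjMatrix ℝ)).bddAbove

theorem rayleigh_s17 (H : SimpleGraph V) (f : V → ℝ) :
    ∑ u, ∑ v, (if H.Adj u v then f u * f v else 0) ≤ specRad H * ∑ u, f u ^ 2 := by
  have hA : (H.adjMatrix ℝ).IsHermitian := by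
    rw [Matrix.IsHermitian, Matrix.conjTranspose_eq_transpose_of_trivial]; simp
  have hM : (algebraMap ℝ (Matrix V V ℝ) (specRad H) - H.adjMatrix ℝ).PosSemidef := by
    rw [Matrix.posSemidef_iff_isHermitian_and_spectrum_nonneg]
    refine ⟨?_, ?_⟩
    · refine Matrix.IsHermitian.sub ?_ hA
      rw [Matrix.IsHermitian, Matrix.conjTranspose_eq_transpose_of_trivial]
      simp [Matrix.algebraMap_eq_diagonal]
    · rw [← spectrum.singleton_sub_eq]
      rintro x ⟨a, ha, b, hb, rfl⟩
      simp only [Set.mem_singleton_iff] at ha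
      subst ha
      have := le_csSup (specRad_bdd H) hb
      simpa [specRad] using this
  have h := hM.dotProduct_mulVec_nonneg f
  rw [Matrix.sub_mulVec, dotProduct_sub] at h
  have e1 : star f ⬝ᵥ (H.adjMatrix ℝ).mulVec f = ∑ u, ∑ v, (if H.Adj u v then f u * f v else 0) := by
    simp only [dotProduct, Matrix.mulVec, Finset.mul_sum, SimpleGraph.adjMatrix_apply]
    refine Finset.sum_congr rfl fun u _ => Finset.sum_congr rfl fun v _ => ?_
    split_ifs <;> simp
  have e2 : star f ⬝ᵥ (algebraMap ℝ (Matrix V V ℝ) (specRad H)).mulVec f = specRad H * ∑ u, f u ^ 2 := by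
    rw [Algebra.algebraMap_eq_smul_one, Matrix.smul_mulVec, Matrix.one_mulVec]
    simp only [dotProduct, Finset.mul_sum, Pi.smul_apply, smul_eq_mul, Pi.star_apply, star_trivial]
    refine Finset.sum_congr rfl fun u _ => by ring
  rw [e1, e2] at h
  linarith

theorem specKey (H H' : SimpleGraph V) (hle : H' ≤ H) (c : ℝ)
    (hc : ∀ u v, H'.Adj u v → c ≤ (H'.degree u : ℝ) * H'.degree v)
    (hρ : specRad H ≤ Real.sqrt c) :
    (∀ u v, H'.Adj u v → (H'.degree u : ℝ) * H'.degree v ≤ c) ∧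
    (∀ u v, H.Adj u v → 0 < H'.degree u → 0 < H'.degree v → H'.Adj u v) := by
  have R := rayleigh_s17 H (fun v => Real.sqrt (H'.degree v))
  have e : ∑ u, (Real.sqrt (H'.degree u : ℝ))^2 = ∑ u, ∑ v, (if H'.Adj u v then (1:ℝ) else 0) := by
    refine Finset.sum_congr rfl fun u _ => ?_
    rw [Real.sq_sqrt (by positivity), Finset.sum_boole, ← SimpleGraph.card_neighborFinset_eq_degree]
    congr 2
    ext v; simp
  have R2 : ∑ u, ∑ v, ((if H.Adj u v then Real.sqrt (H'.degree u) * Real.sqrt (H'.degree v) else 0)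
      - (if H'.Adj u v then Real.sqrt c else 0)) ≤ 0 := by
    simp only [Finset.sum_sub_distrib]
    have : ∑ u, ∑ v, (if H'.Adj u v then Real.sqrt c else 0)
       = Real.sqrt c * ∑ u, (Real.sqrt (H'.degree u : ℝ))^2 := by
      rw [e]; simp only [Finset.mul_sum]
      refine Finset.sum_congr rfl fun u _ => Finset.sum_congr rfl fun v _ => ?_
      split_ifs <;> simp
    rw [this]
    have : specRad H * ∑ u, (Real.sqrt (H'.degree u : ℝ))^2 ≤ Real.sqrt c * ∑ u, (Real.sqrt (H'.degree u : ℝ))^2 :=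
      mul_le_mul_of_nonneg_right hρ (by positivity)
    linarith
  have nn : ∀ u v, 0 ≤ ((if H.Adj u v then Real.sqrt (H'.degree u) * Real.sqrt (H'.degree v) else 0)
      - (if H'.Adj u v then Real.sqrt c else 0)) := by
    intro u v
    by_cases h' : H'.Adj u v
    · rw [if_pos h', if_pos (hle h'), ← Real.sqrt_mul (by positivity), sub_nonneg]
      exact Real.sqrt_le_sqrt (hc u v h')
    · rw [if_neg h', sub_zero]; split_ifs <;> positivity
  have z : ∀ u v, ((if H.Adj u v then Real.sqrt (H'.degree u) * Real.sqrt (H'.degree v) else 0)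
      - (if H'.Adj u v then Real.sqrt c else 0)) = 0 := by
    have h0 := le_antisymm R2 (Finset.sum_nonneg fun u _ => Finset.sum_nonneg fun v _ => nn u v)
    rw [Finset.sum_eq_zero_iff_of_nonneg (fun u _ => Finset.sum_nonneg fun v _ => nn u v)] at h0
    intro u v
    have := h0 u (Finset.mem_univ _)
    rw [Finset.sum_eq_zero_iff_of_nonneg (fun v _ => nn u v)] at this
    exact this v (Finset.mem_univ _)
  constructor
  · intro u v h
    have := z u v
    rw [if_pos h, if_pos (hle h), ← Real.sqrt_mul (by positivity), sub_eq_zero] at this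
    have hpos : 0 < (H'.degree u : ℝ) * H'.degree v := by
      have h1 : 0 < H'.degree u := (H'.degree_pos_iff_exists_adj u).2 ⟨v, h⟩
      have h2 : 0 < H'.degree v := (H'.degree_pos_iff_exists_adj v).2 ⟨u, h.symm⟩
      positivity
    have h3 : 0 < Real.sqrt c := by rw [← this]; exact Real.sqrt_pos.2 hpos
    rw [Real.sqrt_inj hpos.le (Real.sqrt_pos.1 h3).le] at this
    exact this.le
  · intro u v h h1 h2
    by_contra h'
    have := z u v
    rw [if_pos h, if_neg h', sub_zero] at this
    have : 0 < Real.sqrt (H'.degree u : ℝ) * Real.sqrt (H'.degree v) := by positivity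
    linarith

theorem specRad_eq (H : SimpleGraph V) [Nonempty V] (f : V → ℝ) (hf : ∀ v, 0 < f v) (c : ℝ)
    (h : ∀ v, ∑ w, (if H.Adj v w then f w else 0) = c * f v) : specRad H = c := by
  have hmv : ∀ g : V → ℝ, ∀ v, (H.adjMatrix ℝ).mulVec g v = ∑ w, (if H.Adj v w then g w else 0) := by
    intro g v
    simp only [Matrix.mulVec, dotProduct, SimpleGraph.adjMatrix_apply]
    refine Finset.sum_congr rfl fun u _ => by split_ifs <;> simp
  have key : IsGreatest (spectrum ℝ (H.adjMatrix ℝ)) c := by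
    constructor
    · rw [← Matrix.spectrum_toLin', ← Module.End.hasEigenvalue_iff_mem_spectrum]
      refine Module.End.hasEigenvalue_of_hasEigenvector (x := f) ⟨?_, ?_⟩
      · rw [Module.End.mem_eigenspace_iff]
        ext v; simp [hmv, h]
      · intro h0
        have := hf (Classical.arbitrary V)
        rw [h0] at this; simp at this
    · intro μ hμ
      rw [← Matrix.spectrum_toLin', ← Module.End.hasEigenvalue_iff_mem_spectrum] at hμ
      obtain ⟨g, hg, hg0⟩ := hμ.exists_hasEigenvector
      rw [Module.End.mem_eigenspace_iff] at hg
      have hgv : ∀ v, ∑ w, (if H.Adj v w then g w else 0) = μ * g v := by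
        intro v
        have := congrFun hg v
        simpa [hmv] using this
      have h1 : ∀ v, μ * |g v| ≤ ∑ w, (if H.Adj v w then |g w| else 0) := by
        intro v
        calc μ * |g v| ≤ |μ * g v| := by rw [abs_mul]; exact mul_le_mul_of_nonneg_right (le_abs_self _) (abs_nonneg _)
          _ = |∑ w, (if H.Adj v w then g w else 0)| := by rw [hgv]
          _ ≤ ∑ w, |(if H.Adj v w then g w else 0)| := Finset.abs_sum_le_sum_abs _ _
          _ = _ := Finset.sum_congr rfl fun w _ => by split_ifs <;> simp
      have h2 : μ * ∑ v, f v * |g v| ≤ c * ∑ v, f v * |g v| := by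
        calc μ * ∑ v, f v * |g v| = ∑ v, f v * (μ * |g v|) := by
              rw [Finset.mul_sum]; exact Finset.sum_congr rfl fun w _ => by ring
          _ ≤ ∑ v, f v * ∑ w, (if H.Adj v w then |g w| else 0) :=
              Finset.sum_le_sum fun v _ => mul_le_mul_of_nonneg_left (h1 v) (hf v).le
          _ = ∑ w, ∑ v, (if H.Adj w v then f v else 0) * |g w| := by
              simp only [Finset.mul_sum]
              rw [Finset.sum_comm]
              refine Finset.sum_congr rfl fun u _ => Finset.sum_congr rfl fun v _ => ?_
              rw [H.adj_comm]; split_ifs <;> simp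
          _ = c * ∑ v, f v * |g v| := by
              rw [Finset.mul_sum]
              refine Finset.sum_congr rfl fun u _ => ?_
              rw [← Finset.sum_mul, h]; ring
      have h3 : 0 < ∑ v, f v * |g v| := by
        obtain ⟨v, hv⟩ := Function.ne_iff.1 hg0
        refine Finset.sum_pos' (fun v _ => mul_nonneg (hf v).le (abs_nonneg _)) ⟨v, Finset.mem_univ _, ?_⟩
        exact mul_pos (hf v) (abs_pos.2 hv)
      exact le_of_mul_le_mul_right h2 h3
  exact key.csSup_eq

end spec

section main

theorem qc_adj {n : ℕ} (G : SimpleGraph (Fin n ⊕ Fin n)) (a b : Fin n ⊕ Fin n) :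
    (quasiComplement G).Adj a b ↔ (a.isLeft ≠ b.isLeft ∧ ¬ G.Adj a b) := by
  rcases a with a | a <;> rcases b with b | b <;>
    simp [quasiComplement, SimpleGraph.fromRel_adj, SimpleGraph.adj_comm]

theorem cross_iff {n : ℕ} (G : SimpleGraph (Fin n ⊕ Fin n)) :
    CrossOnly G ↔ ∀ a b, G.Adj a b → a.isLeft ≠ b.isLeft := by
  constructor
  · rintro ⟨h1, h2⟩ (a | a) (b | b) h <;> simp_all
  · intro h
    exact ⟨fun x y hh => by simpa using h _ _ hh, fun x y hh => by simpa using h _ _ hh⟩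

theorem card_opp {n : ℕ} (a : Fin n ⊕ Fin n) :
    (Finset.univ.filter (fun b : Fin n ⊕ Fin n => a.isLeft ≠ b.isLeft)).card = n := by
  rw [Finset.card_filter, Fintype.sum_sum_type]
  rcases a with a | a <;> simp

theorem qc_degree {n : ℕ} (G : SimpleGraph (Fin n ⊕ Fin n)) (h : CrossOnly G) (a : Fin n ⊕ Fin n) :
    (quasiComplement G).degree a + G.degree a = n := by
  rw [cross_iff] at h
  rw [← SimpleGraph.card_neighborFinset_eq_degree, ← SimpleGraph.card_neighborFinset_eq_degree,
    ← Finset.card_union_of_disjoint]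
  · conv_rhs => rw [← card_opp a]
    congr 1
    ext b
    have := h a b
    simp only [Finset.mem_union, SimpleGraph.mem_neighborFinset, qc_adj, Finset.mem_filter, Finset.mem_univ, true_and]
    tauto
  · rw [Finset.disjoint_left]
    intro b
    simp only [SimpleGraph.mem_neighborFinset, qc_adj]
    tauto

theorem qc_anti {n : ℕ} {G G' : SimpleGraph (Fin n ⊕ Fin n)} (h : G ≤ G') :
    quasiComplement G' ≤ quasiComplement G := by
  intro a b
  rw [qc_adj, qc_adj]
  exact fun ⟨h1, h2⟩ => ⟨h1, fun h3 => h2 (h h3)⟩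

theorem R_adj {n k : ℕ} (a b : Fin n ⊕ Fin n) : (Rgraph n k).Adj a b ↔
    (a.isLeft ≠ b.isLeft ∧ ((Sum.elim Fin.val Fin.val a < k) ↔ (Sum.elim Fin.val Fin.val b < k))) := by
  rcases a with a | a <;> rcases b with b | b <;>
    simp [Rgraph, SimpleGraph.fromRel_adj] <;> omega

theorem card_lt' {n k : ℕ} (h : k ≤ n) : (Finset.univ.filter (fun i : Fin n => i.val < k)).card = k := by
  rw [Fin.card_filter_val_lt]; omega

theorem card_ge' {n k : ℕ} (h : k ≤ n) : (Finset.univ.filter (fun i : Fin n => ¬ i.val < k)).card = n - k := by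
  have := Finset.card_filter_add_card_filter_not (s := (Finset.univ : Finset (Fin n))) (fun i => i.val < k)
  rw [card_lt' h] at this
  simp at this ⊢; omega

theorem R_spec {n k : ℕ} (hk : 1 ≤ k) (hn : 2*k ≤ n) :
    specRad (quasiComplement (Rgraph n k)) = Real.sqrt ((k : ℝ) * ((n : ℝ) - k)) := by
  have hkn : (k:ℝ) < n := by exact_mod_cast (by omega : k < n)
  have hk0 : (0:ℝ) < k := by exact_mod_cast (by omega : 0 < k)
  have hnk : (0:ℝ) < n - k := by linarith
  have cst : ((n - k : ℕ) : ℝ) = n - k := by rw [Nat.cast_sub (by omega)]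
  have : Nonempty (Fin n ⊕ Fin n) := ⟨Sum.inl ⟨0, by omega⟩⟩
  set p := Real.sqrt k with hp
  set q := Real.sqrt ((n:ℝ)-k) with hq
  have hpp : p * p = k := Real.mul_self_sqrt hk0.le
  have hqq : q * q = n - k := Real.mul_self_sqrt hnk.le
  rw [Real.sqrt_mul hk0.le, ← hp, ← hq]
  have s1 : ∀ c : ℝ, ∑ x : Fin n, (if x.val < k then c else 0) = k * c := by
    intro c
    rw [← Finset.sum_filter, Finset.sum_const, card_lt' (by omega), nsmul_eq_mul]
  have s2 : ∀ c : ℝ, ∑ x : Fin n, (if ¬ x.val < k then c else 0) = (n - k) * c := by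
    intro c
    rw [← Finset.sum_filter, Finset.sum_const, card_ge' (by omega), nsmul_eq_mul, cst]
  have main : ∀ x : Fin n, ∑ y : Fin n, (if ¬ ((x.val < k) ↔ (y.val < k)) then (if y.val < k then q else p) else 0)
      = p * q * (if x.val < k then q else p) := by
    intro x
    by_cases hx : x.val < k
    · simp only [hx, true_iff, if_true]
      rw [show p * q * q = (n - k) * p by rw [← hqq]; ring, ← s2]
      refine Finset.sum_congr rfl fun y _ => ?_
      by_cases hy : y.val < k <;> simp [hy]
    · simp only [hx, false_iff, if_false, not_not]
      rw [show p * q * p = k * q by rw [← hpp]; ring, ← s1]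
      refine Finset.sum_congr rfl fun y _ => ?_
      by_cases hy : y.val < k <;> simp [hy]
  refine specRad_eq _ (fun v => if Sum.elim Fin.val Fin.val v < k then q else p) ?_ _ ?_
  · intro v
    have : 0 < q := Real.sqrt_pos.2 hnk
    have : 0 < p := Real.sqrt_pos.2 hk0
    split_ifs <;> assumption
  · rintro (x | x)
    · rw [Fintype.sum_sum_type]
      simp only [qc_adj, R_adj]
      have hm := main x
      simp [-mul_ite] at hm ⊢
      convert hm using 2
      all_goals first
        | (refine Finset.sum_congr rfl fun y _ => ?_; split_ifs <;> rfl)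
        | (split_ifs <;> rfl)
        | (congr 1 <;> split_ifs <;> rfl)
    · rw [Fintype.sum_sum_type]
      simp only [qc_adj, R_adj]
      have hm := main x
      simp [-mul_ite] at hm ⊢
      convert hm using 2
      all_goals first
        | (refine Finset.sum_congr rfl fun y _ => ?_; split_ifs <;> rfl)
        | (split_ifs <;> rfl)
        | (congr 1 <;> split_ifs <;> rfl)

/-- the standard zigzag numbering -/
def zz (n : ℕ) (i : Fin (2*n)) : Fin n ⊕ Fin n :=
  if i.val % 2 = 0 then Sum.inl ⟨i.val/2, by omega⟩ else Sum.inr ⟨i.val/2, by omega⟩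

theorem zz_left {n : ℕ} (i : Fin (2*n)) : (zz n i).isLeft = true ↔ i.val % 2 = 0 := by
  unfold zz; split_ifs with h <;> simp [h]

theorem zz_val {n : ℕ} (i : Fin (2*n)) : Sum.elim Fin.val Fin.val (zz n i) = i.val / 2 := by
  unfold zz; split_ifs with h <;> simp

theorem zz_bij (n : ℕ) : Function.Bijective (zz n) := by
  rw [Fintype.bijective_iff_injective_and_card]
  refine ⟨?_, by simp; omega⟩
  intro i j h
  have h1 := zz_left i
  have h2 := zz_left j
  have h3 := zz_val i
  have h4 := zz_val j
  rw [h] at h1 h3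
  ext
  have : i.val % 2 = 0 ↔ j.val % 2 = 0 := h1.symm.trans h2
  omega

/-- A Hamilton path numbering. -/
theorem traceable_of_num {n : ℕ} (hn : 0 < n) (G : SimpleGraph (Fin n ⊕ Fin n)) (p : Fin (2*n) → Fin n ⊕ Fin n)
    (hp : p.Bijective) (h : ∀ i : ℕ, ∀ hi : i + 1 < 2*n, G.Adj (p ⟨i, by omega⟩) (p ⟨i+1, hi⟩)) :
    G.IsTraceable := by
  let e : ℕ → Fin n ⊕ Fin n := fun i => if hi : i < 2*n then p ⟨i, hi⟩ else Sum.inl ⟨0, hn⟩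
  have he : ∀ i (hi : i < 2*n), e i = p ⟨i, hi⟩ := fun i hi => by simp [e, hi]
  have := HP.up (K := G.comap e) (a := 0) (b := 2*n-1) (by omega) (by
    intro i _ hi
    simp only [SimpleGraph.comap_adj]
    rw [he i (by omega), he (i+1) (by omega)]
    exact h i (by omega))
  have h2 := this.map (by
    intro i hi j hj hij
    simp only [Set.mem_Icc] at hi hj
    rw [he i (by omega), he j (by omega)] at hij
    simpa using hp.1 hij)
  refine (h2.congr ?_).traceable
  rw [Set.eq_univ_iff_forall]
  intro v
  obtain ⟨i, rfl⟩ := hp.2 v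
  refine ⟨i.val, by simp; omega, by rw [he i.val i.2]⟩

theorem complete_traceable {n : ℕ} (hn : 0 < n) (G : SimpleGraph (Fin n ⊕ Fin n))
    (h : ∀ x y, G.Adj (Sum.inl x) (Sum.inr y)) : G.IsTraceable := by
  refine traceable_of_num hn G (zz n) (zz_bij n) ?_
  intro i hi
  unfold zz
  rcases Nat.mod_two_eq_zero_or_one i with h0 | h0
  · rw [if_pos h0, if_neg (by simp; omega)]; exact h _ _
  · rw [if_neg (by simp; omega), if_pos (by simp; omega)]; exact (h _ _).symm

theorem traceable_path {V : Type*} {G : SimpleGraph V} (h : G.IsTraceable) :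
    ∃ (u v : V) (p : G.Walk u v), p.IsPath ∧ ∀ x, x ∈ p.support := by
  obtain ⟨u, v, p, hp⟩ := h
  exact ⟨u, v, p, hp.isPath, hp.mem_support⟩

/-- extracting the configuration -/
theorem exists_cfg {n : ℕ} (G : SimpleGraph (Fin n ⊕ Fin n)) (hG : CrossOnly G)
    (hnt : ¬ G.IsTraceable) (a b : Fin n ⊕ Fin n) (hab : a.isLeft ≠ b.isLeft)
    (ht : (G ⊔ SimpleGraph.edge a b).IsTraceable) :
    ∃ (p : ℕ → Fin n ⊕ Fin n) (r : ℕ), Set.InjOn p (Set.Iio (2*n)) ∧ (∀ v, ∃ i < 2*n, p i = v) ∧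
      Cfg (G.comap p) n r ∧ ((p r = a ∧ p (r+1) = b) ∨ (p r = b ∧ p (r+1) = a)) ∧
      (∀ i < 2*n, ∀ j < 2*n, (p i).isLeft ≠ (p j).isLeft ↔ i % 2 ≠ j % 2) := by
  rw [cross_iff] at hG
  obtain ⟨u, v, w, hw0, hw1⟩ := traceable_path ht
  have hw := hw0.isHamiltonian_iff.2 hw1
  have hn : 0 < n := by rcases u with u | u <;> exact u.pos
  have hlen : w.length = 2*n - 1 := by
    have := hw.length_eq
    simp at this; omega
  have inj : Set.InjOn w.getVert (Set.Iio (2*n)) := by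
    refine hw0.getVert_injOn.mono ?_
    intro i; simp; omega
  have surj : ∀ v, ∃ i < 2*n, w.getVert i = v := by
    intro v
    obtain ⟨i, h1, h2⟩ := SimpleGraph.Walk.mem_support_iff_exists_getVert.1 (hw1 v)
    exact ⟨i, by omega, h1⟩
  have adj : ∀ i, i + 1 < 2*n → (G ⊔ SimpleGraph.edge a b).Adj (w.getVert i) (w.getVert (i+1)) :=
    fun i hi => w.adj_getVert_succ (by omega)
  have alt : ∀ i, i + 1 < 2*n → (w.getVert i).isLeft ≠ (w.getVert (i+1)).isLeft := by
    intro i hi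
    have := adj i hi
    rw [SimpleGraph.sup_adj, SimpleGraph.edge_adj] at this
    rcases this with h | ⟨⟨h1, h2⟩ | ⟨h1, h2⟩, -⟩
    · exact hG _ _ h
    · rw [h1, h2]; exact hab
    · rw [h1, h2]; exact hab.symm
  have par : ∀ i, i < 2*n → ((w.getVert i).isLeft = (w.getVert 0).isLeft ↔ i % 2 = 0) := by
    intro i
    induction i with
    | zero => simp
    | succ i ih =>
      intro hi
      have h1 := ih (by omega)
      have h2 := alt i hi
      have : (w.getVert (i+1)).isLeft = (w.getVert 0).isLeft ↔ ¬ (w.getVert i).isLeft = (w.getVert 0).isLeft := by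
        generalize (w.getVert (i+1)).isLeft = x at *
        generalize (w.getVert 0).isLeft = y at *
        generalize (w.getVert i).isLeft = z at *
        revert h2; clear h1 ih
        revert x y z; decide
      rw [this, h1]; omega
  have par2 : ∀ i < 2*n, ∀ j < 2*n, (w.getVert i).isLeft ≠ (w.getVert j).isLeft ↔ i % 2 ≠ j % 2 := by
    intro i hi j hj
    have h1 := par i hi
    have h2 := par j hj
    have : (w.getVert i).isLeft ≠ (w.getVert j).isLeft ↔
      ¬ ((w.getVert i).isLeft = (w.getVert 0).isLeft ↔ (w.getVert j).isLeft = (w.getVert 0).isLeft) := by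
      generalize (w.getVert i).isLeft = x
      generalize (w.getVert 0).isLeft = y
      generalize (w.getVert j).isLeft = z
      revert x y z; decide
    rw [this, h1, h2]
    constructor
    · intro h h'; apply h; rw [h']
    · intro h h'; apply h; omega
  have ntI : ∀ u v, ¬ HP (G.comap w.getVert) (Set.Iio (2*n)) u v := by
    intro u v h
    refine hnt ((h.map inj).congr ?_).traceable
    rw [Set.eq_univ_iff_forall]
    intro v
    obtain ⟨i, h1, h2⟩ := surj v
    exact ⟨i, h1, h2⟩
  have exr : ∃ r, r + 1 < 2*n ∧ ¬ G.Adj (w.getVert r) (w.getVert (r+1)) := by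
    by_contra hcon
    push Not at hcon
    refine ntI 0 (2*n-1) ((HP.up (by omega) (fun i _ hi => ?_)).congr ?_)
    · exact hcon i (by omega)
    · ext x; simp; omega
  obtain ⟨r, hr, hnr⟩ := exr
  have ends : ∀ i, i + 1 < 2*n → ¬ G.Adj (w.getVert i) (w.getVert (i+1)) →
      ((w.getVert i = a ∧ w.getVert (i+1) = b) ∨ (w.getVert i = b ∧ w.getVert (i+1) = a)) := by
    intro i hi h
    have := adj i hi
    rw [SimpleGraph.sup_adj, SimpleGraph.edge_adj] at this
    tauto
  refine ⟨w.getVert, r, inj, surj, ⟨hr, ?_, ?_, ntI⟩, ends r hr hnr, par2⟩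
  · intro i hi j hj h
    exact (par2 i hi j hj).1 (hG _ _ h)
  · intro i hi hne
    by_contra hcon
    have e1 := ends i hi hcon
    have e2 := ends r hr hnr
    have inj' : ∀ i < 2*n, ∀ j < 2*n, w.getVert i = w.getVert j → i = j := fun i hi j hj h => inj hi hj h
    rcases e1 with e1 | e1 <;> rcases e2 with e2 | e2
    · exact hne (inj' i (by omega) r (by omega) (e1.1.trans e2.1.symm))
    · have := inj' i (by omega) (r+1) (by omega) (e1.1.trans e2.2.symm)
      have := inj' (i+1) (by omega) r (by omega) (e1.2.trans e2.1.symm)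
      omega
    · have := inj' i (by omega) (r+1) (by omega) (e1.1.trans e2.2.symm)
      have := inj' (i+1) (by omega) r (by omega) (e1.2.trans e2.1.symm)
      omega
    · exact hne (inj' i (by omega) r (by omega) (e1.1.trans e2.1.symm))

theorem dg_comap {n : ℕ} (G : SimpleGraph (Fin n ⊕ Fin n)) (p : ℕ → Fin n ⊕ Fin n)
    (inj : Set.InjOn p (Set.Iio (2*n))) (surj : ∀ v, ∃ i < 2*n, p i = v) (i : ℕ) :
    dg (G.comap p) n i = G.degree (p i) := by
  rw [← SimpleGraph.card_neighborFinset_eq_degree]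
  apply Finset.card_bij (fun t _ => p t)
  · intro t ht
    simp at ht ⊢; exact ht.2
  · intro a ha b hb h
    simp at ha hb
    exact inj ha.1 hb.1 h
  · intro v hv
    obtain ⟨j, hj, rfl⟩ := surj v
    refine ⟨j, ?_, rfl⟩
    simp at hv ⊢; exact ⟨hj, hv⟩

theorem iso_R {n k : ℕ} (G : SimpleGraph (Fin n ⊕ Fin n)) (p : ℕ → Fin n ⊕ Fin n)
    (inj : Set.InjOn p (Set.Iio (2*n))) (surj : ∀ v, ∃ i < 2*n, p i = v)
    (h : ∀ i < 2*n, ∀ j < 2*n, G.Adj (p i) (p j) ↔ (i % 2 ≠ j % 2 ∧ (i < 2*k ↔ j < 2*k))) :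
    Nonempty (G ≃g Rgraph n k) := by
  have pb : Function.Bijective (fun i : Fin (2*n) => p i.val) := by
    constructor
    · intro i j hij
      exact Fin.ext (inj i.2 j.2 hij)
    · intro v
      obtain ⟨i, hi, rfl⟩ := surj v
      exact ⟨⟨i, hi⟩, rfl⟩
  let e := Equiv.ofBijective _ pb
  let z := Equiv.ofBijective _ (zz_bij n)
  refine ⟨⟨e.symm.trans z, ?_⟩⟩
  intro a b
  obtain ⟨i, rfl⟩ := e.surjective a
  obtain ⟨j, rfl⟩ := e.surjective b
  have e1 : e i = p i.val := rfl
  have e2 : e j = p j.val := rfl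
  simp only [Equiv.trans_apply, Equiv.symm_apply_apply]
  rw [e1, e2, h i i.2 j j.2, R_adj]
  have z1 : z i = zz n i := rfl
  have z2 : z j = zz n j := rfl
  rw [z1, z2, zz_val, zz_val]
  have h1 := zz_left i
  have h2 := zz_left j
  have : (zz n i).isLeft ≠ (zz n j).isLeft ↔ ¬ ((zz n i).isLeft = true ↔ (zz n j).isLeft = true) := by
    generalize (zz n i).isLeft = x
    generalize (zz n j).isLeft = y
    revert x y; decide
  rw [this, h1, h2]
  have t1 : i.val / 2 < k ↔ i.val < 2*k := by omega
  have t2 : j.val / 2 < k ↔ j.val < 2*k := by omega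
  have t3 : (¬ (i.val % 2 = 0 ↔ j.val % 2 = 0)) ↔ i.val % 2 ≠ j.val % 2 := by omega
  rw [t1, t2, t3]

end main

theorem stmt_17 (n k : ℕ) (G : SimpleGraph (Fin n ⊕ Fin n)) (hbip : CrossOnly G)
    (hk : 1 ≤ k) (hn : 2 * k ≤ n) (hdeg : ∀ v, k ≤ G.degree v)
    (hρ : specRad (quasiComplement G) ≤ specRad (quasiComplement (Rgraph n k))) :
    specRad (quasiComplement (Rgraph n k)) = Real.sqrt ((k : ℝ) * ((n : ℝ) - k)) ∧
    (G.IsTraceable ∨ Nonempty (G ≃g Rgraph n k)) := by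
  refine ⟨R_spec hk hn, ?_⟩
  by_contra hcon
  push Not at hcon
  obtain ⟨hnt, hniso⟩ := hcon
  rw [R_spec hk hn] at hρ
  obtain ⟨G', hle, hmax⟩ := Finite.exists_le_maximal
    (p := fun G' : SimpleGraph (Fin n ⊕ Fin n) => CrossOnly G' ∧ ¬ G'.IsTraceable) ⟨hbip, hnt⟩
  obtain ⟨hc', hnt'⟩ := hmax.prop
  have hdeg' : ∀ v, k ≤ G'.degree v := fun v =>
    (hdeg v).trans (SimpleGraph.degree_le_of_le hle)
  -- adding any missing cross edge gives a traceable graph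
  have hadd : ∀ a b, a.isLeft ≠ b.isLeft → ¬ G'.Adj a b → (G' ⊔ SimpleGraph.edge a b).IsTraceable := by
    intro a b hab hnab
    by_contra ht
    have hne : a ≠ b := fun h => hab (by rw [h])
    have : CrossOnly (G' ⊔ SimpleGraph.edge a b) := by
      rw [cross_iff] at hc' ⊢
      intro u v h
      rw [SimpleGraph.sup_adj, SimpleGraph.edge_adj] at h
      rcases h with h | ⟨⟨h1, h2⟩ | ⟨h1, h2⟩, -⟩
      · exact hc' _ _ h
      · rw [h1, h2]; exact hab
      · rw [h1, h2]; exact hab.symm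
    have h2 := hmax.le_of_ge ⟨this, ht⟩ le_sup_left
    apply hnab
    apply h2
    rw [SimpleGraph.sup_adj, SimpleGraph.edge_adj]
    exact Or.inr ⟨Or.inl ⟨rfl, rfl⟩, hne⟩
  have hclose : ∀ a b, a.isLeft ≠ b.isLeft → ¬ G'.Adj a b → G'.degree a + G'.degree b ≤ n := by
    intro a b hab hnab
    obtain ⟨p, r, inj, surj, c, hends, -⟩ := exists_cfg G' hc' hnt' a b hab (hadd a b hab hnab)
    have : dg (G'.comap p) n r + dg (G'.comap p) n (r+1) ≤ n := by
      rcases Nat.mod_two_eq_zero_or_one r with h | h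
      · exact (c.closure_even h).le
      · exact c.closure_odd h
    rw [dg_comap G' p inj surj, dg_comap G' p inj surj] at this
    rcases hends with ⟨h1, h2⟩ | ⟨h1, h2⟩ <;> rw [h1, h2] at this <;> omega
  have hq := qc_degree G' hc'
  have hprod : ∀ u v, (quasiComplement G').Adj u v →
      (k:ℝ) * ((n:ℝ) - k) ≤ ((quasiComplement G').degree u : ℝ) * (quasiComplement G').degree v := by
    intro u v h
    rw [qc_adj] at h
    have h1 := hclose u v h.1 h.2
    have a1 := hq u; have a2 := hq v; have b1 := hdeg' u; have b2 := hdeg' v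
    generalize (quasiComplement G').degree u = x at *
    generalize (quasiComplement G').degree v = y at *
    have c1 : (x:ℝ) + k ≤ n := by exact_mod_cast (by omega : x + k ≤ n)
    have c2 : (y:ℝ) + k ≤ n := by exact_mod_cast (by omega : y + k ≤ n)
    have c3 : (n:ℝ) ≤ x + y := by exact_mod_cast (by omega : n ≤ x + y)
    have c4 : (0:ℝ) ≤ x := by positivity
    nlinarith [mul_nonneg c4 (sub_nonneg.2 c3), mul_nonneg (sub_nonneg.2 c1) (by linarith : (0:ℝ) ≤ x - k)]
  obtain ⟨S1, S2⟩ := specKey (quasiComplement G) (quasiComplement G') (qc_anti hle) _ hprod hρ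
  have hdd : ∀ u v, u.isLeft ≠ v.isLeft → ¬ G'.Adj u v →
      G'.degree u + G'.degree v = n ∧ (G'.degree u = k ∨ G'.degree u = n - k) := by
    intro u v h h'
    have s := S1 u v ((qc_adj _ _ _).2 ⟨h, h'⟩)
    have h1 := hclose u v h h'
    have a1 := hq u; have a2 := hq v; have b1 := hdeg' u; have b2 := hdeg' v
    generalize (quasiComplement G').degree u = x at *
    generalize (quasiComplement G').degree v = y at *
    have c1 : (x:ℝ) + k ≤ n := by exact_mod_cast (by omega : x + k ≤ n)
    have c2 : (y:ℝ) + k ≤ n := by exact_mod_cast (by omega : y + k ≤ n)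
    have c3 : (n:ℝ) ≤ x + y := by exact_mod_cast (by omega : n ≤ x + y)
    have c4 : (0:ℝ) < x := by exact_mod_cast (by omega : 0 < x)
    have d1 := mul_nonneg c4.le (sub_nonneg.2 c3)
    have d2 := mul_nonneg (sub_nonneg.2 c1) (by linarith : (0:ℝ) ≤ x - k)
    have f1 : (x:ℝ) * (x + y - n) = 0 := by nlinarith
    have f2 : ((n:ℝ) - (x + k)) * (x - k) = 0 := by nlinarith
    have g1 : (x:ℝ) + y = n := by
      rcases mul_eq_zero.1 f1 with h | h <;> linarith
    have g1' : x + y = n := by exact_mod_cast g1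
    refine ⟨by omega, ?_⟩
    rcases mul_eq_zero.1 f2 with h | h
    · have : (n:ℝ) = x + k := by linarith
      have : n = x + k := by exact_mod_cast this
      omega
    · have : (x:ℝ) = k := by linarith
      have : x = k := by exact_mod_cast this
      omega
  have hmiss : ∃ x y, ¬ G'.Adj (Sum.inl x) (Sum.inr y) := by
    by_contra h
    push Not at h
    exact hnt' (complete_traceable (by omega) G' h)
  obtain ⟨x, y, hxy⟩ := hmiss
  obtain ⟨p, r, inj, surj, c, hends, par⟩ := exists_cfg G' hc' hnt' (Sum.inl x) (Sum.inr y) (by simp)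
    (hadd _ _ (by simp) hxy)
  have hr := c.hr
  have hD := dg_comap G' p inj surj
  have hsum : ∀ i < 2*n, ∀ j < 2*n, i % 2 ≠ j % 2 → ¬ (G'.comap p).Adj i j →
      dg (G'.comap p) n i + dg (G'.comap p) n j = n := by
    intro i hi j hj hij hadj
    rw [hD, hD]
    exact (hdd _ _ ((par i hi j hj).2 hij) hadj).1
  have ho : r % 2 = 1 := by
    by_contra h
    have h1 := c.closure_even (by omega)
    have h2 := hsum r (by omega) (r+1) (by omega) (by omega) (c.nojoin c.P1 c.P2)
    omega
  obtain ⟨m0, hcomp⟩ := c.complete ho hsum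
  -- every vertex has a non-neighbour on the other side
  have hpos : ∀ v, 0 < (quasiComplement G').degree v := by
    intro v
    obtain ⟨i, hi, rfl⟩ := surj v
    rw [SimpleGraph.degree_pos_iff_exists_adj]
    have : ∃ j < 2*n, i % 2 ≠ j % 2 ∧ ¬ (i ≤ r ↔ j ≤ r) := by
      by_cases h : i ≤ r
      · by_cases h2 : i % 2 = 0
        · exact ⟨r+2, by omega, by omega, by omega⟩
        · exact ⟨r+1, by omega, by omega, by omega⟩
      · by_cases h2 : i % 2 = 0
        · exact ⟨1, by omega, by omega, by omega⟩
        · exact ⟨0, by omega, by omega, by omega⟩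
    obtain ⟨j, hj, h1, h2⟩ := this
    refine ⟨p j, (qc_adj _ _ _).2 ⟨(par i hi j hj).2 h1, fun h => ?_⟩⟩
    exact h2 ((hcomp i hi j hj).1 h).2
  have hGG : G' = G := by
    refine le_antisymm ?_ hle
    intro a b hab
    by_contra hn
    have h1 := (cross_iff G').1 hc' a b hab
    have h2 := S2 a b ((qc_adj _ _ _).2 ⟨h1, hn⟩) (hpos a) (hpos b)
    exact ((qc_adj _ _ _).1 h2).2 hab
  have m1 : (r+1)/2 = k ∨ (r+1)/2 = n - k := by
    rw [← m0, hD]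
    have h1 : ¬ (G'.comap p).Adj 0 (r+2) := by
      rw [hcomp 0 (by omega) (r+2) (by omega)]; omega
    exact (hdd _ _ ((par 0 (by omega) (r+2) (by omega)).2 (by omega)) h1).2
  apply hniso.false
  rw [← hGG]
  apply Classical.choice
  rcases m1 with m1 | m1
  · refine iso_R G' p inj surj ?_
    intro i hi j hj
    have := hcomp i hi j hj
    rw [SimpleGraph.comap_adj] at this
    rw [this, show i ≤ r ↔ i < 2*k by omega, show j ≤ r ↔ j < 2*k by omega]
  · refine iso_R G' (fun i => p (rv n i)) ?_ ?_ ?_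
    · intro i hi j hj h
      refine rv_inj n hi hj (inj ?_ ?_ h) <;> simp [rv] <;> omega
    · intro v
      obtain ⟨i, hi, rfl⟩ := surj v
      exact ⟨rv n i, by simp [rv]; omega, by rw [rv_rv hi]⟩
    · intro i hi j hj
      have := hcomp (rv n i) (by simp [rv]; omega) (rv n j) (by simp [rv]; omega)
      rw [SimpleGraph.comap_adj] at this
      rw [this]
      have t1 : rv n i ≤ r ↔ ¬ i < 2*k := by simp only [rv]; omega
      have t2 : rv n j ≤ r ↔ ¬ j < 2*k := by simp only [rv]; omega
      have t3 : rv n i % 2 ≠ rv n j % 2 ↔ i % 2 ≠ j % 2 := by simp only [rv]; omega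
      rw [t1, t2, t3, not_iff_not]
end
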